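/- arXiv:math/0509313 — 2 statements merged into one kernel-verified Lean document; each statement's English description precedes it below -/
import Mathlib

section
/- Let X be a finite graph, let R ⊆ X^+ × X^+ be a synchronously regular relation, let m ≥ 0 and let f : X^m → X^* be a function such that (x f) alpha = x alpha for all x in X^m. Then the binary relation R' = {(u, v (x f)) : (u, v x) ∈ R, u ∈ X^+, v ∈ X^*, x ∈ X^m} is synchronously regular. -/
/- Common framework: graphs, path languages, synchronous regularity,
   semigroupoids, automatic structures, and Rees matrix constructions. -/

namespace AutoRees

/-- Raw data of a semigroupoid: source and target maps on arrows together with a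
totalised multiplication (whose values are only meaningful on composable pairs). -/
structure PreSgpd (O A : Type) where
  src : A → O
  tgt : A → O
  mul : A → A → A

/-- A semigroupoid: the multiplication respects sources and targets and is
associative, on composable pairs. -/
structure Sgpd (O A : Type) extends PreSgpd O A where
  src_mul : ∀ e f, tgt e = src f → src (mul e f) = src e
  tgt_mul : ∀ e f, tgt e = src f → tgt (mul e f) = tgt f
  mul_assoc' : ∀ e f g, tgt e = src f → tgt f = src g →
    mul (mul e f) g = mul e (mul f g)

/-- Evaluate a nonempty word of edge labels as a product in the semigroupoid
(`none` on the empty word). -/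
def evalPath? {O A E : Type} (S : PreSgpd O A) (lab : E → A) : List E → Option A
  | [] => none
  | e :: l => some ((l.map lab).foldl S.mul (lab e))

/-- The consecutive-compatibility condition making a list of edges a path. -/
def IsPathChain {V E : Type} (esrc etgt : E → V) (l : List E) : Prop :=
  List.Chain' (fun e f => etgt e = esrc f) l

/-- The target of a non-empty path. -/
def pathTgt? {V E : Type} (etgt : E → V) (l : List E) : Option V :=
  l.getLast?.map etgt

/-- The source of a non-empty path. -/
def pathSrc? {V E : Type} (esrc : E → V) (l : List E) : Option V :=
  l.head?.map esrc

/-- A set of words is regular if it is a regular language in the usual sense. -/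
def IsRegularSet {α : Type} (L : Set (List α)) : Prop :=
  Language.IsRegular (show Language α from L)

/-- The padding symbol used to pad a pair of paths, at the target of `l`
(the letters of the padded alphabet `X^$` are `Sum.inl` (a genuine edge) or
`Sum.inr (some v)` (the padding edge at vertex `v`)). -/
def padSym {V E : Type} (etgt : E → V) (l : List E) : E ⊕ Option V :=
  Sum.inr (l.getLast?.map etgt)

/-- The padded convolution `(a, b) δ_X` of a pair of paths. -/
def deltaPair {V E : Type} (etgt : E → V) (a b : List E) :
    List ((E ⊕ Option V) × (E ⊕ Option V)) :=
  (a.map Sum.inl).zip (b.map Sum.inl) ++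
    (if a.length ≤ b.length
      then (b.drop a.length).map (fun e => (padSym etgt a, Sum.inl e))
      else (a.drop b.length).map (fun e => (Sum.inl e, padSym etgt b)))

/-- A binary relation on paths is synchronously regular if its image under the
padding map is a regular language over the padded product alphabet. -/
def SyncRegular {V E : Type} (etgt : E → V) (R : Set (List E × List E)) : Prop :=
  IsRegularSet { w | ∃ p ∈ R, w = deltaPair etgt p.1 p.2 }

/-- A choice of representatives `(X, K, ρ)` for a semigroupoid `S`: a graph `X`
with vertex set `S^0` (edge set `E`, source `esrc`, target `etgt`), a semigroupoid
morphism `ρ : X^+ → S` (induced by the edge-labelling `lab`), and a language `K`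
of non-empty paths with `K ρ = S^1`. -/
structure ChoiceOfReps {O A : Type} (S : PreSgpd O A) (E : Type) where
  esrc : E → O
  etgt : E → O
  lab : E → A
  lab_src : ∀ e, S.src (lab e) = esrc e
  lab_tgt : ∀ e, S.tgt (lab e) = etgt e
  K : Set (List E)
  K_path : ∀ l ∈ K, l ≠ [] ∧ IsPathChain esrc etgt l
  K_onto : ∀ a : A, ∃ l ∈ K, evalPath? S lab l = some a

variable {O A E : Type} {S : PreSgpd O A}

/-- The relation `K_=` = {(u,v) ∈ K × K : u ρ = v ρ}. -/
def relEq (C : ChoiceOfReps S E) : Set (List E × List E) :=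
  { p | p.1 ∈ C.K ∧ p.2 ∈ C.K ∧ evalPath? S C.lab p.1 = evalPath? S C.lab p.2 }

/-- The relation `K_a` for an edge `a` of `X`. -/
def relEdge (C : ChoiceOfReps S E) (a : E) : Set (List E × List E) :=
  { p | p.1 ∈ C.K ∧ p.2 ∈ C.K ∧ pathTgt? C.etgt p.1 = some (C.esrc a) ∧
        evalPath? S C.lab (p.1 ++ [a]) = evalPath? S C.lab p.2 }

/-- The relation `K_a` for a vertex `a` of `X` (regarded as the empty path at `a`). -/
def relVertex (C : ChoiceOfReps S E) (v : O) : Set (List E × List E) :=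
  { p | p.1 ∈ C.K ∧ p.2 ∈ C.K ∧ pathTgt? C.etgt p.1 = some v ∧
        evalPath? S C.lab p.1 = evalPath? S C.lab p.2 }

/-- An automatic structure: a finitely generated choice of representatives with
`K` regular such that `K_a` is synchronously regular for every edge and vertex. -/
def IsAutomaticStructure (C : ChoiceOfReps S E) : Prop :=
  Finite E ∧ IsRegularSet C.K ∧
    (∀ a : E, SyncRegular C.etgt (relEdge C a)) ∧
    (∀ v : O, SyncRegular C.etgt (relVertex C v))

/-- The set of non-empty prefixes of words in `K`. -/
def prefs {E : Type} (K : Set (List E)) : Set (List E) :=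
  { p | p ≠ [] ∧ ∃ l ∈ K, p <+: l }

/-- The relation `K'_=` = {(u,v) ∈ K × Pref(K) : u ρ = v ρ}. -/
def relPrefEq (C : ChoiceOfReps S E) : Set (List E × List E) :=
  { p | p.1 ∈ C.K ∧ p.2 ∈ prefs C.K ∧ evalPath? S C.lab p.1 = evalPath? S C.lab p.2 }

/-- A prefix-automatic structure. -/
def IsPrefixAutomaticStructure (C : ChoiceOfReps S E) : Prop :=
  IsAutomaticStructure C ∧ SyncRegular C.etgt (relPrefEq C)

/-- A cross-section: `ρ` restricted to `K` is injective. -/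
def IsCrossSection (C : ChoiceOfReps S E) : Prop :=
  ∀ u ∈ C.K, ∀ v ∈ C.K, evalPath? S C.lab u = evalPath? S C.lab v → u = v

/-- `K` is closed under taking non-empty prefixes. -/
def IsPrefixClosed (C : ChoiceOfReps S E) : Prop :=
  ∀ l ∈ C.K, ∀ p : List E, p ≠ [] → p <+: l → p ∈ C.K

/-- A semigroupoid (or semigroup, in the one-object case) is automatic if it
admits an automatic structure. -/
def IsAutomatic (S : PreSgpd O A) : Prop :=
  ∃ (E : Type) (C : ChoiceOfReps S E), IsAutomaticStructure C

/-- Prefix-automaticity. -/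
def IsPrefixAutomatic (S : PreSgpd O A) : Prop :=
  ∃ (E : Type) (C : ChoiceOfReps S E), IsPrefixAutomaticStructure C

/-- Finite generation: every arrow is a (composable) product of arrows from some
fixed finite set. -/
def IsFG (S : PreSgpd O A) : Prop :=
  ∃ T : Set A, T.Finite ∧ ∀ a : A, ∃ l : List A, l ≠ [] ∧ (∀ x ∈ l, x ∈ T) ∧
    IsPathChain S.src S.tgt l ∧ evalPath? S id l = some a

/-- An arrow is an identity if it acts as an identity on all composable products. -/
def IsIdentity (S : PreSgpd O A) (e : A) : Prop :=
  (∀ x, S.tgt e = S.src x → S.mul e x = x) ∧ (∀ y, S.tgt y = S.src e → S.mul y e = y)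

/-- A small category is a semigroupoid with an identity arrow at every object. -/
def IsSmallCategory (S : PreSgpd O A) : Prop :=
  ∀ v : O, ∃ e : A, S.src e = v ∧ S.tgt e = v ∧ IsIdentity S e

/-- No object is isolated. -/
def IsolationFree (S : PreSgpd O A) : Prop :=
  ∀ v : O, ∃ a : A, S.src a = v ∨ S.tgt a = v

namespace Rees

variable {O A I Λ : Type}

/-- A triple `(i, x, λ)` is valid if `i F = x α` and `x ω = λ G`. -/
def Valid (S : Sgpd O A) (F : I → O) (G : Λ → O) (t : I × A × Λ) : Prop :=
  F t.1 = S.src t.2.1 ∧ S.tgt t.2.1 = G t.2.2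

/-- The set of valid Rees triples. -/
def Triples (S : Sgpd O A) (F : I → O) (G : Λ → O) : Type :=
  { t : I × A × Λ // Valid S F G t }

theorem prod_valid (S : Sgpd O A) {F : I → O} {G : Λ → O}
    {i : I} {x : A} {lam : Λ} {j : I} {y : A} {mu : Λ} {p : A}
    (hx : Valid S F G (i, x, lam)) (hy : Valid S F G (j, y, mu))
    (hps : S.src p = G lam) (hpt : S.tgt p = F j) :
    Valid S F G (i, S.mul (S.mul x p) y, mu) := by
  obtain ⟨hx1, hx2⟩ := hx
  obtain ⟨hy1, hy2⟩ := hy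
  have h1 : S.tgt x = S.src p := by rw [hps]; exact hx2
  have h2 : S.tgt p = S.src y := by rw [hpt]; exact hy1
  have h3 : S.tgt (S.mul x p) = S.src y := by rw [S.tgt_mul x p h1]; exact h2
  constructor
  · show F i = S.src (S.mul (S.mul x p) y)
    rw [S.src_mul _ y h3, S.src_mul x p h1]; exact hx1
  · show S.tgt (S.mul (S.mul x p) y) = G mu
    rw [S.tgt_mul _ y h3]; exact hy2

/-- Data for a Rees matrix construction with zero over a semigroupoid `S`:
indexing functions `F`, `G` surjective onto the sets of sources and of targets
respectively, and a sandwich matrix `P` with entries in `S^1 ∪ {0}`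
(`none` representing `0`) compatible with `F` and `G`. -/
structure Data0 (S : Sgpd O A) (I Λ : Type) where
  F : I → O
  G : Λ → O
  P : Λ → I → Option A
  F_into : ∀ i, ∃ a : A, S.src a = F i
  F_onto : ∀ a : A, ∃ i, F i = S.src a
  G_into : ∀ lam, ∃ a : A, S.tgt a = G lam
  G_onto : ∀ a : A, ∃ lam, G lam = S.tgt a
  P_src : ∀ lam i p, P lam i = some p → S.src p = G lam
  P_tgt : ∀ lam i p, P lam i = some p → S.tgt p = F i

/-- Underlying set of the Rees matrix semigroup with zero (`none` is the zero). -/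
def Carrier0 (S : Sgpd O A) (R : Data0 S I Λ) : Type :=
  Option (Triples S R.F R.G)

/-- Multiplication of the Rees matrix semigroup with zero. -/
def mul0 (S : Sgpd O A) (R : Data0 S I Λ) :
    Carrier0 S R → Carrier0 S R → Carrier0 S R
  | some ⟨(i, x, lam), hx⟩, some ⟨(j, y, mu), hy⟩ =>
    match hp : R.P lam j with
    | some p => some ⟨(i, S.mul (S.mul x p) y, mu),
        prod_valid S hx hy (R.P_src lam j p hp) (R.P_tgt lam j p hp)⟩
    | none => none
  | none, _ => none
  | _, none => none

/-- The Rees matrix semigroup with zero `M^0(S; F(I), G(Λ); P)`, as a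
one-object semigroupoid (i.e. a semigroup). -/
def pre0 (S : Sgpd O A) (R : Data0 S I Λ) : PreSgpd Unit (Carrier0 S R) where
  src _ := ()
  tgt _ := ()
  mul := mul0 S R

/-- Data for a Rees matrix construction without zero (no zero entries in `P`). -/
structure Data (S : Sgpd O A) (I Λ : Type) where
  F : I → O
  G : Λ → O
  P : Λ → I → A
  F_into : ∀ i, ∃ a : A, S.src a = F i
  F_onto : ∀ a : A, ∃ i, F i = S.src a
  G_into : ∀ lam, ∃ a : A, S.tgt a = G lam
  G_onto : ∀ a : A, ∃ lam, G lam = S.tgt a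
  P_src : ∀ lam i, S.src (P lam i) = G lam
  P_tgt : ∀ lam i, S.tgt (P lam i) = F i

/-- Underlying set of the Rees matrix semigroup without zero. -/
def Carrier (S : Sgpd O A) (R : Data S I Λ) : Type :=
  Triples S R.F R.G

/-- Multiplication of the Rees matrix semigroup without zero. -/
def mul (S : Sgpd O A) (R : Data S I Λ) :
    Carrier S R → Carrier S R → Carrier S R
  | ⟨(i, x, lam), hx⟩, ⟨(j, y, mu), hy⟩ =>
    ⟨(i, S.mul (S.mul x (R.P lam j)) y, mu),
      prod_valid S hx hy (R.P_src lam j) (R.P_tgt lam j)⟩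

/-- The Rees matrix semigroup without zero `M(S; F(I), G(Λ); P)`, as a
one-object semigroupoid (i.e. a semigroup). -/
def pre (S : Sgpd O A) (R : Data S I Λ) : PreSgpd Unit (Carrier S R) where
  src _ := ()
  tgt _ := ()
  mul := mul S R

/-- The set `S P' S` of arrows of the form `s p t` with `p` a non-zero entry of `P`. -/
def SPS0 (S : Sgpd O A) (R : Data0 S I Λ) : Set A :=
  { a | ∃ s p t lam i, R.P lam i = some p ∧ S.tgt s = S.src p ∧ S.tgt p = S.src t ∧
        a = S.mul (S.mul s p) t }

/-- The set `S P S` for a matrix without zero entries. -/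
def SPS (S : Sgpd O A) (R : Data S I Λ) : Set A :=
  { a | ∃ s t lam i, S.tgt s = S.src (R.P lam i) ∧ S.tgt (R.P lam i) = S.src t ∧
        a = S.mul (S.mul s (R.P lam i)) t }

/-- The set of targets of arrows of `S` (the codomain of `G`). -/
def tgtSet (S : Sgpd O A) : Set O := { v | ∃ a : A, S.tgt a = v }

/-- `T` is strongly right-ideal-generated by a row cross-section of `P`. -/
def StronglyRIG0 (S : Sgpd O A) (R : Data0 S I Λ) (T : Set A) : Prop :=
  ∃ Λ' : Set Λ, Set.BijOn R.G Λ' (tgtSet S) ∧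
    ∀ t ∈ T, ∃ lam ∈ Λ', ∃ i p s, R.P lam i = some p ∧ S.tgt p = S.src s ∧
      t = S.mul p s

/-- `T` is weakly right-ideal-generated by a row cross-section of `P`. -/
def WeaklyRIG0 (S : Sgpd O A) (R : Data0 S I Λ) (T : Set A) : Prop :=
  ∃ Λ' : Set Λ, Set.BijOn R.G Λ' (tgtSet S) ∧
    ∀ t ∈ T, ∃ lam ∈ Λ', ∃ i p, R.P lam i = some p ∧
      (t = p ∨ ∃ s, S.tgt p = S.src s ∧ t = S.mul p s)

/-- Weak right-ideal generation, for a matrix without zero entries. -/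
def WeaklyRIG (S : Sgpd O A) (R : Data S I Λ) (T : Set A) : Prop :=
  ∃ Λ' : Set Λ, Set.BijOn R.G Λ' (tgtSet S) ∧
    ∀ t ∈ T, ∃ lam ∈ Λ', ∃ i,
      (t = R.P lam i ∨ ∃ s, S.tgt (R.P lam i) = S.src s ∧ t = S.mul (R.P lam i) s)

end Rees


section Helpers

variable {V E : Type} (etgt : E → V)

/-- Updated padding vertex after reading a word. -/
def pd : Option V → List E → Option V
  | p, [] => p
  | _, e :: l => pd (some (etgt e)) l

/-- Recursive version of the padded convolution. -/
def conv : Option V → Option V → List E → List E → List ((E ⊕ Option V) × (E ⊕ Option V))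
  | _, _, [], [] => []
  | p, _, [], e :: b => (Sum.inr p, Sum.inl e) :: conv p (some (etgt e)) [] b
  | _, q, e :: a, [] => (Sum.inl e, Sum.inr q) :: conv (some (etgt e)) q a []
  | _, _, e :: a, e' :: b =>
    (Sum.inl e, Sum.inl e') :: conv (some (etgt e)) (some (etgt e')) a b

/-- Suffixes `a, b` may continue the padded pair `s, t`. -/
def Compat (s t a b : List E) : Prop :=
  (s.length < t.length → a = []) ∧ (t.length < s.length → b = [])

/-- Residual of a relation. -/
def Res (R : Set (List E × List E)) (z : List E × List E) : Set (List E × List E) :=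
  { p | Compat z.1 z.2 p.1 p.2 ∧ (z.1 ++ p.1, z.2 ++ p.2) ∈ R }

theorem pd_eq (p : Option V) (l : List E) : pd etgt p l = (l.getLast?.map etgt).or p := by
  induction l generalizing p with
  | nil => simp [pd]
  | cons e l ih =>
    rw [pd, ih]
    cases h : l.getLast? with
    | none => simp [List.getLast?_cons, h]
    | some x => simp [List.getLast?_cons, h]

theorem conv_nil_left (p q : Option V) (b : List E) :
    conv etgt p q [] b = b.map (fun e => (Sum.inr p, Sum.inl e)) := by
  induction b generalizing q with
  | nil => simp [conv]
  | cons e b ih => simp [conv, ih]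

theorem conv_nil_right (p q : Option V) (a : List E) :
    conv etgt p q a [] = a.map (fun e => (Sum.inl e, Sum.inr q)) := by
  induction a generalizing p with
  | nil => simp [conv]
  | cons e b ih => simp [conv, ih]

theorem conv_eq (p q : Option V) (a b : List E) :
    conv etgt p q a b = (a.map Sum.inl).zip (b.map Sum.inl) ++
    (if a.length ≤ b.length
      then (b.drop a.length).map (fun e => (Sum.inr (pd etgt p a), Sum.inl e))
      else (a.drop b.length).map (fun e => (Sum.inl e, Sum.inr (pd etgt q b)))) := by
  induction a generalizing p q b with
  | nil => simp [conv_nil_left, pd]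
  | cons e a ih =>
    cases b with
    | nil => simp [conv_nil_right, pd]
    | cons e' b => simp [conv, ih, pd]

theorem deltaPair_eq (a b : List E) : deltaPair etgt a b = conv etgt none none a b := by
  rw [conv_eq, deltaPair]
  simp [padSym, pd_eq]

theorem conv_length (p q : Option V) (a b : List E) :
    (conv etgt p q a b).length = max a.length b.length := by
  induction a generalizing p q b with
  | nil => simp [conv_nil_left]
  | cons e a ih =>
    cases b with
    | nil => simp [conv_nil_right]
    | cons e' b => simp [conv, ih]

theorem conv_fst (p q : Option V) (a b : List E) :
    (conv etgt p q a b).filterMap (fun x => x.1.getLeft?) = a := by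
  induction a generalizing p q b with
  | nil => simp [conv_nil_left, Function.comp_def]
  | cons e a ih =>
    cases b with
    | nil => simp [conv_nil_right, Function.comp_def]
    | cons e' b => simp [conv, ih]

theorem conv_snd (p q : Option V) (a b : List E) :
    (conv etgt p q a b).filterMap (fun x => x.2.getLeft?) = b := by
  induction a generalizing p q b with
  | nil => simp [conv_nil_left, Function.comp_def]
  | cons e a ih =>
    cases b with
    | nil => simp [conv_nil_right, Function.comp_def]
    | cons e' b => simp [conv, ih]

theorem conv_inj {p q p' q' : Option V} {a b a' b' : List E}
    (h : conv etgt p q a b = conv etgt p' q' a' b') : a = a' ∧ b = b' := by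
  constructor
  · rw [← conv_fst etgt p q a b, h, conv_fst]
  · rw [← conv_snd etgt p q a b, h, conv_snd]

theorem conv_append (p q : Option V) (s t a b : List E) (h : Compat s t a b) :
    conv etgt p q (s ++ a) (t ++ b) =
      conv etgt p q s t ++ conv etgt (pd etgt p s) (pd etgt q t) a b := by
  induction s generalizing p q t with
  | nil =>
    cases t with
    | nil => simp [conv, pd]
    | cons e t =>
      have : a = [] := h.1 (by simp)
      subst this
      simp [conv_nil_left, pd]
  | cons e s ih =>
    cases t with
    | nil =>
      have : b = [] := h.2 (by simp)
      subst this
      simp [conv_nil_right, pd]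
    | cons e' t =>
      have h' : Compat s t a b := by simpa [Compat] using h
      simp [conv, pd, ih _ _ _ h']

theorem conv_split (p q : Option V) (u z : List E)
    (W T : List ((E ⊕ Option V) × (E ⊕ Option V))) (h : W ++ T = conv etgt p q u z) :
    ∃ s t a b, u = s ++ a ∧ z = t ++ b ∧ Compat s t a b ∧ W = conv etgt p q s t ∧
      T = conv etgt (pd etgt p s) (pd etgt q t) a b := by
  have hl := congrArg List.length h
  rw [conv_length, List.length_append] at hl
  have hc : Compat (u.take W.length) (z.take W.length) (u.drop W.length) (z.drop W.length) := by
    constructor <;> intro h1 <;> simp only [List.length_take] at h1 <;>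
      simp only [List.drop_eq_nil_iff] <;> omega
  have h2 := conv_append etgt p q _ _ _ _ hc
  rw [List.take_append_drop, List.take_append_drop, ← h] at h2
  obtain ⟨h3, h4⟩ := List.append_inj h2 (by
    rw [conv_length]; simp only [List.length_take]; omega)
  exact ⟨_, _, _, _, (List.take_append_drop _ _).symm, (List.take_append_drop _ _).symm,
    hc, h3, h4⟩

theorem finite_range_of_factor {α β γ : Type*} {g : α → β} {h : α → γ}
    (hg : (Set.range g).Finite) (H : ∀ x y, g x = g y → h x = h y) :
    (Set.range h).Finite := by
  classical
  rcases isEmpty_or_nonempty α with hα | hα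
  · rw [Set.range_eq_empty]; exact Set.finite_empty
  refine (hg.image (fun b => h (Function.invFun g b))).subset ?_
  rintro _ ⟨x, rfl⟩
  refine ⟨g x, ⟨x, rfl⟩, ?_⟩
  exact H _ _ (Function.invFun_eq ⟨x, rfl⟩)

theorem finite_range_prod {α β γ : Type*} {g : α → β} {h : α → γ}
    (hg : (Set.range g).Finite) (hh : (Set.range h).Finite) :
    (Set.range (fun x => (g x, h x))).Finite := by
  refine (hg.prod hh).subset ?_
  rintro _ ⟨x, rfl⟩
  exact ⟨⟨x, rfl⟩, ⟨x, rfl⟩⟩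

theorem finite_range_pi {α ι β : Type*} [Finite ι] {g : ι → α → β}
    (hg : ∀ i, (Set.range (g i)).Finite) :
    (Set.range (fun x i => g i x)).Finite := by
  refine (Set.Finite.pi hg).subset ?_
  rintro _ ⟨x, rfl⟩ i _
  exact ⟨x, rfl⟩

theorem syncRegular_iff [Finite V] (R : Set (List E × List E)) :
    SyncRegular etgt R ↔ (Set.range (Res R)).Finite := by
  unfold SyncRegular IsRegularSet
  rw [Language.isRegular_iff_finite_range_leftQuotient]
  set L : Language ((E ⊕ Option V) × (E ⊕ Option V)) :=
    { w | ∃ p ∈ R, w = deltaPair etgt p.1 p.2 } with hL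
  have memL : ∀ w, w ∈ L ↔ ∃ p ∈ R, w = conv etgt none none p.1 p.2 := by
    intro w
    simp only [← deltaPair_eq]
    exact Iff.rfl
  change (Set.range L.leftQuotient).Finite ↔ _
  constructor
  · intro h
    have h1 : (Set.range (fun z : List E × List E =>
        ((L.leftQuotient (conv etgt none none z.1 z.2), (pd etgt none z.1, pd etgt none z.2)),
          ((z.1.length < z.2.length : Prop), (z.2.length < z.1.length : Prop))))).Finite := by
      refine finite_range_prod (finite_range_prod (h.subset ?_) (Set.toFinite _)) (Set.toFinite _)
      rintro _ ⟨z, rfl⟩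
      exact ⟨_, rfl⟩
    refine finite_range_of_factor h1 ?_
    have key : ∀ z : List E × List E, Res R z = { p | ((z.1.length < z.2.length → p.1 = []) ∧
        (z.2.length < z.1.length → p.2 = [])) ∧
        conv etgt (pd etgt none z.1) (pd etgt none z.2) p.1 p.2 ∈
          L.leftQuotient (conv etgt none none z.1 z.2) } := by
      intro z
      ext p
      refine and_congr_right fun hc => ?_
      rw [Language.mem_leftQuotient, ← conv_append _ _ _ _ _ _ _ hc, memL]
      constructor
      · intro hp
        exact ⟨_, hp, rfl⟩
      · rintro ⟨⟨u, v⟩, hp, he⟩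
        obtain ⟨h1, h2⟩ := conv_inj _ he
        rw [h1, h2]; exact hp
    intro x y hxy
    simp only [Prod.mk.injEq] at hxy
    obtain ⟨⟨h1, h2, h3⟩, h4, h5⟩ := hxy
    rw [key, key, h1, h2, h3, h4, h5]
  · intro h
    have h1 : (Set.range (fun x : (Option V × Option V) × Set.range (Res R) =>
        (show Language ((E ⊕ Option V) × (E ⊕ Option V)) from
          (fun p : List E × List E => conv etgt x.1.1 x.1.2 p.1 p.2) '' x.2.1))).Finite := by
      have := h.to_subtype
      exact Set.toFinite _
    refine (h1.union (Set.finite_singleton (∅ : Set (List ((E ⊕ Option V) × (E ⊕ Option V)))))).subset ?_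
    rintro _ ⟨W, rfl⟩
    by_cases hW : ∃ s t, W = conv etgt none none s t
    · left
      obtain ⟨s, t, rfl⟩ := hW
      refine ⟨((pd etgt none s, pd etgt none t), ⟨_, (s, t), rfl⟩), ?_⟩
      ext T
      rw [Language.mem_leftQuotient, memL]
      constructor
      · rintro ⟨⟨a, b⟩, ⟨hc, hp⟩, rfl⟩
        exact ⟨_, hp, (conv_append _ _ _ _ _ _ _ hc).symm⟩
      · rintro ⟨⟨u, v⟩, hp, he⟩
        obtain ⟨s', t', a, b, h1, h2, hc, hW, rfl⟩ := conv_split _ _ _ _ _ _ _ he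
        obtain ⟨rfl, rfl⟩ := conv_inj _ hW
        simp only at h1 h2
        subst h1 h2
        exact ⟨(a, b), ⟨hc, hp⟩, rfl⟩
    · right
      refine Set.eq_empty_of_forall_notMem fun T hT => hW ?_
      have hT' : T ∈ L.leftQuotient W := hT
      rw [Language.mem_leftQuotient, memL] at hT'
      obtain ⟨⟨u, v⟩, hp, he⟩ := hT'
      obtain ⟨s', t', a, b, h1, h2, hc, hW, rfl⟩ := conv_split _ _ _ _ _ _ _ he
      exact ⟨_, _, hW⟩

/-- Slack lemma. -/
theorem slack [Finite E] {R : Set (List E × List E)} (h : (Set.range (Res R)).Finite) (d : ℕ) :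
    { A : Set (List E) | ∃ s z : List E, z.length ≤ s.length + d ∧
      A = { a | (s ++ a, z) ∈ R } }.Finite := by
  have h1 : (Set.range (fun x : Set.range (Res R) × {e : List E | e.length ≤ d} =>
      { a | (a, x.2.1) ∈ x.1.1 })).Finite := by
    have := h.to_subtype
    have := (List.finite_length_le E d).to_subtype
    exact Set.toFinite _
  refine h1.subset ?_
  rintro _ ⟨s, z, hz, rfl⟩
  refine ⟨(⟨_, (s, z.take s.length), rfl⟩, ⟨z.drop s.length, by simp; omega⟩), ?_⟩
  ext a
  simp only [Res, Set.mem_setOf_eq, List.take_append_drop, Compat, List.length_take,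
    List.drop_eq_nil_iff]
  refine and_iff_right ⟨by omega, by omega⟩

/-- Partial residual with modified end of the second component. -/
def ResA (R : Set (List E × List E)) (j : ℕ) (c : List E) (z : List E × List E) :
    Set (List E) :=
  { a | (z.1.length < z.2.length → a = []) ∧
    (z.1 ++ a, z.2.take (z.2.length - j) ++ c) ∈ R }

/-- Residual with an extra suffix. -/
def ResB (R : Set (List E × List E)) (c : List E) (z : List E × List E) :
    Set (List E × List E) :=
  { p | Compat z.1 z.2 p.1 p.2 ∧ (z.1 ++ p.1, z.2 ++ (p.2 ++ c)) ∈ R }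

theorem finite_ResA [Finite E] {R : Set (List E × List E)} (h : (Set.range (Res R)).Finite)
    (j : ℕ) (c : List E) : (Set.range (ResA R j c)).Finite := by
  refine ((slack h c.length).union
    (Set.toFinite ({∅, {[]}} : Set (Set (List E))))).subset ?_
  rintro _ ⟨⟨s, t⟩, rfl⟩
  by_cases hst : s.length < t.length
  · right
    have : ResA R j c (s, t) ⊆ {[]} := fun a ha => ha.1 hst
    simpa using Set.subset_singleton_iff_eq.1 this
  · left
    refine ⟨s, t.take (t.length - j) ++ c, by simp; omega, ?_⟩
    ext a
    simp [ResA, hst]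

theorem finite_ResB [Finite E] {R : Set (List E × List E)} (h : (Set.range (Res R)).Finite)
    (c : List E) : (Set.range (ResB R c)).Finite := by
  refine ((h.image (fun S => { p : List E × List E | (p.1, p.2 ++ c) ∈ S })).union
    ((finite_ResA h 0 c).image
      (fun S => { p : List E × List E | p.2 = [] ∧ p.1 ∈ S }))).subset ?_
  rintro _ ⟨⟨s, t⟩, rfl⟩
  by_cases hst : t.length < s.length
  · right
    refine ⟨_, ⟨(s, t), rfl⟩, ?_⟩
    have h3 : ¬ s.length < t.length := by omega
    ext ⟨a, b⟩
    simp only [ResA, ResB, Compat, Set.mem_setOf_eq, hst, h3, forall_const, false_imp_iff,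
      true_and, Nat.sub_zero, List.take_length]
    constructor
    · rintro ⟨rfl, h⟩; exact ⟨rfl, by simpa using h⟩
    · rintro ⟨rfl, h⟩; exact ⟨rfl, by simpa using h⟩
  · left
    refine ⟨_, ⟨(s, t), rfl⟩, ?_⟩
    ext ⟨a, b⟩
    simp [Res, ResB, Compat, hst]

end Helpers

/-- Proposition 3.1: changing the last `m` letters of the second component of a
synchronously regular relation by a source-preserving function preserves
synchronous regularity. -/
theorem stmt_0 {V E : Type} [Finite V] [Finite E]
    (esrc etgt : E → V) (R : Set (List E × List E))
    (hRpath : ∀ p ∈ R, p.1 ≠ [] ∧ IsPathChain esrc etgt p.1 ∧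
      p.2 ≠ [] ∧ IsPathChain esrc etgt p.2)
    (hR : SyncRegular etgt R)
    (m : ℕ) (f : V → List E → List E)
    (hfPath : ∀ v x, x.length = m → IsPathChain esrc etgt x →
      IsPathChain esrc etgt (f v x))
    (hfSrc : ∀ v x, x.length = m → IsPathChain esrc etgt x →
      ∀ e ∈ (f v x).head?, esrc e = x.head?.elim v esrc) :
    SyncRegular etgt
      { q | ∃ u w x v, (u, w ++ x) ∈ R ∧ x.length = m ∧
            (x.head?.map esrc = some v ∨ (x = [] ∧ w.getLast?.map etgt = some v)) ∧
            q = (u, w ++ f v x) } := by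
  have hfin := (syncRegular_iff etgt R).1 hR
  rw [syncRegular_iff]
  have : Finite {x : List E // x.length = m} := (List.finite_length_eq E m).to_subtype
  obtain ⟨K, hK⟩ : ∃ K : ℕ, ∀ v x, x.length = m → (f v x).length ≤ K := by
    obtain ⟨K, hK⟩ := (Set.finite_range
      (fun p : V × {x : List E // x.length = m} => (f p.1 p.2.1).length)).bddAbove
    exact ⟨K, fun v x hx => hK ⟨(v, ⟨x, hx⟩), rfl⟩⟩
  have hA : (Set.range (fun (z : List E × List E)
      (i : Fin (K + 1) × {x : List E // x.length = m}) => ResA R i.1 i.2.1 z)).Finite :=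
    finite_range_pi (fun i => finite_ResA hfin _ _)
  have hB : (Set.range (fun (z : List E × List E)
      (i : {x : List E // x.length = m}) => ResB R i.1 z)).Finite :=
    finite_range_pi (fun i => finite_ResB hfin _)
  have hG : (Set.range (fun (z : List E × List E) (j : Fin (K + 1)) =>
      (z.2.take (z.2.length - j)).getLast?)).Finite := Set.toFinite _
  have hD : (Set.range (fun (z : List E × List E) (j : Fin (K + 1)) =>
      z.2.drop (z.2.length - j))).Finite := by
    refine finite_range_pi (g := fun (j : Fin (K + 1)) (z : List E × List E) =>
      z.2.drop (z.2.length - j)) (fun j => (List.finite_length_le E K).subset ?_)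
    rintro _ ⟨z, rfl⟩
    simp
    omega
  have hC : (Set.range (fun z : List E × List E =>
      ((z.1.length < z.2.length : Prop), (z.2.length < z.1.length : Prop)))).Finite :=
    Set.toFinite _
  refine finite_range_of_factor
    (finite_range_prod (finite_range_prod hA hB)
      (finite_range_prod (finite_range_prod hG hD) hC)) ?_
  suffices H : ∀ z z' : List E × List E,
      (∀ (j : Fin (K + 1)) (x : {x : List E // x.length = m}), ResA R j x.1 z = ResA R j x.1 z') →
      (∀ (x : {x : List E // x.length = m}), ResB R x.1 z = ResB R x.1 z') →
      (∀ (j : Fin (K + 1)), (z.2.take (z.2.length - j)).getLast? =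
        (z'.2.take (z'.2.length - j)).getLast?) →
      (∀ (j : Fin (K + 1)), z.2.drop (z.2.length - j) = z'.2.drop (z'.2.length - j)) →
      ((z.1.length < z.2.length) = (z'.1.length < z'.2.length)) →
      ((z.2.length < z.1.length) = (z'.2.length < z'.1.length)) →
      Res { q | ∃ u w x v, (u, w ++ x) ∈ R ∧ x.length = m ∧
            (x.head?.map esrc = some v ∨ (x = [] ∧ w.getLast?.map etgt = some v)) ∧
            q = (u, w ++ f v x) } z ⊆
      Res { q | ∃ u w x v, (u, w ++ x) ∈ R ∧ x.length = m ∧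
            (x.head?.map esrc = some v ∨ (x = [] ∧ w.getLast?.map etgt = some v)) ∧
            q = (u, w ++ f v x) } z' by
    intro z z' hz
    simp only [Prod.mk.injEq] at hz
    obtain ⟨⟨h1, h2⟩, ⟨h3, h4⟩, h5, h6⟩ := hz
    have e1 := fun j x => congrFun h1 (j, x)
    have e2 := fun x => congrFun h2 x
    have e3 := fun x => congrFun h3 x
    have e4 := fun x => congrFun h4 x
    exact Set.Subset.antisymm (H z z' e1 e2 e3 e4 h5 h6)
      (H z' z (fun j x => (e1 j x).symm) (fun x => (e2 x).symm) (fun x => (e3 x).symm)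
        (fun x => (e4 x).symm) h5.symm h6.symm)
  rintro ⟨s, t⟩ ⟨s', t'⟩ h1 h2 h3 h4 h5 h6 ⟨a, b⟩ ⟨hc, u, w, x, v, hR', hx, hv, heq⟩
  simp only [Prod.mk.injEq] at heq h3 h4 h5 h6 hc
  obtain ⟨rfl, heq⟩ := heq
  have hc' : Compat s' t' a b := by
    unfold Compat at hc ⊢
    rwa [← h5, ← h6]
  refine ⟨hc', ?_⟩
  rcases List.append_eq_append_iff.1 heq with ⟨c, rfl, rfl⟩ | ⟨c, rfl, hfc⟩
  · -- here w extends t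
    have hm : (a, c) ∈ ResB R x (s, t) := by
      refine ⟨⟨hc.1, fun h => ?_⟩, by simpa using hR'⟩
      have := hc.2 h
      simp at this
      exact this.1
    rw [h2 ⟨x, hx⟩] at hm
    refine ⟨s' ++ a, t' ++ c, x, v, by simpa using hm.2, hx, ?_, by simp⟩
    have h30 := h3 0
    simp only [Fin.val_zero, Nat.sub_zero, List.take_length] at h30
    rw [List.getLast?_append, ← h30, ← List.getLast?_append]
    exact hv
  · -- here t extends w
    have hcl : c.length ≤ K := by
      have := hK v x hx
      rw [hfc] at this
      simp at this
      omega
    have hm : a ∈ ResA R c.length x (s, w ++ c) := by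
      refine ⟨hc.1, by simpa using hR'⟩
    have g1 := h1 ⟨c.length, by omega⟩ ⟨x, hx⟩
    have g3 := h3 ⟨c.length, by omega⟩
    have g4 := h4 ⟨c.length, by omega⟩
    simp only at g1
    rw [g1] at hm
    simp only [List.length_append, Nat.add_sub_cancel, List.take_left', List.drop_left'] at g3 g4
    refine ⟨s' ++ a, t'.take (t'.length - c.length), x, v, hm.2, hx, ?_, ?_⟩
    · rw [← g3]; exact hv
    · have : t' = t'.take (t'.length - c.length) ++ c := by
        conv_lhs => rw [← List.take_append_drop (t'.length - c.length) t', ← g4]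
      rw [hfc, ← List.append_assoc, ← this]

end AutoRees
end

section
/- Let M = M^0(S; F(I), G(Lambda); P) be a Rees matrix semigroup with zero over a small category S. Suppose S is automatic (as a semigroupoid) and M is finitely generated (as a semigroup). Then M is an automatic semigroup. -/
/- Common framework: graphs, path languages, synchronous regularity,
   semigroupoids, automatic structures, and Rees matrix constructions. -/

namespace AutoRees

variable {O A E : Type} {S : PreSgpd O A}

/-! ### Streams and finite families closed under derivatives -/

/-- Prepend a letter to a stream. -/
def scons {B : Type} (a : B) (s : ℕ → B) : ℕ → B
  | 0 => a
  | n + 1 => s n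

/-- A set of streams which belongs to a finite family closed under letter derivatives. -/
def FinQ {B : Type} (W : Set (ℕ → B)) : Prop :=
  ∃ (Q : Type) (_ : Finite Q) (fam : Q → Set (ℕ → B)) (step : Q → B → Q) (q0 : Q),
    (∀ q a s, scons a s ∈ fam q ↔ s ∈ fam (step q a)) ∧ fam q0 = W

theorem scons_eta {B : Type} (s : ℕ → B) : s = scons (s 0) (fun n => s (n + 1)) := by
  funext n; cases n <;> rfl

theorem scons_inj {B : Type} {a b : B} {s t : ℕ → B} :
    scons a s = scons b t ↔ a = b ∧ s = t := by
  constructor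
  · intro h
    exact ⟨congrFun h 0, funext fun n => congrFun h (n + 1)⟩
  · rintro ⟨rfl, rfl⟩; rfl

theorem comp_scons {B C : Type} (h : B → C) (a : B) (s : ℕ → B) :
    (fun n => h (scons a s n)) = scons (h a) (fun n => h (s n)) := by
  funext n; cases n <;> rfl

theorem FinQ.of_fam {B Q : Type} [Finite Q] (fam : Q → Set (ℕ → B))
    (h : ∀ q a, ∃ q', ∀ s, scons a s ∈ fam q ↔ s ∈ fam q') (q : Q) : FinQ (fam q) := by
  choose step hstep using h
  exact ⟨Q, inferInstance, fam, step, q, hstep, rfl⟩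

theorem FinQ.compl {B : Type} {W : Set (ℕ → B)} (h : FinQ W) : FinQ Wᶜ := by
  obtain ⟨Q, _, fam, step, q0, hs, rfl⟩ := h
  exact ⟨Q, inferInstance, fun q => (fam q)ᶜ, step, q0, fun q a s => not_congr (hs q a s), rfl⟩

theorem FinQ.iUnion {B ι : Type} [Finite ι] {W : ι → Set (ℕ → B)} (h : ∀ i, FinQ (W i)) :
    FinQ (⋃ i, W i) := by
  choose Q hQ fam step q0 hs hW using h
  refine ⟨∀ i, Q i, inferInstance, fun q => ⋃ i, fam i (q i), fun q a i => step i (q i) a, q0,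
    ?_, ?_⟩
  · intro q a s
    simp [hs]
  · simp [hW]

theorem FinQ.inter {B : Type} {W V : Set (ℕ → B)} (h : FinQ W) (h' : FinQ V) :
    FinQ (W ∩ V) := by
  obtain ⟨Q, _, fam, step, q0, hs, rfl⟩ := h
  obtain ⟨Q', _, fam', step', q0', hs', rfl⟩ := h'
  refine ⟨Q × Q', inferInstance, fun q => fam q.1 ∩ fam' q.2,
    fun q a => (step q.1 a, step' q.2 a), (q0, q0'), ?_, rfl⟩
  intro q a s
  simp [hs, hs']

theorem FinQ.empty {B : Type} : FinQ (∅ : Set (ℕ → B)) :=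
  FinQ.of_fam (Q := Unit) (fun _ => ∅) (fun _ _ => ⟨(), fun _ => Iff.rfl⟩) ()

theorem FinQ.preimage {B C : Type} {W : Set (ℕ → C)} (h : FinQ W) (f : B → C) :
    FinQ {s : ℕ → B | (fun n => f (s n)) ∈ W} := by
  obtain ⟨Q, _, fam, step, q0, hs, rfl⟩ := h
  refine ⟨Q, inferInstance, fun q => {s : ℕ → B | (fun n => f (s n)) ∈ fam q},
    fun q a => step q (f a), q0, ?_, rfl⟩
  intro q a s
  show (fun n => f (scons a s n)) ∈ fam q ↔ _
  rw [comp_scons, hs]; rfl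

theorem FinQ.image {B C : Type} {W : Set (ℕ → B)} (h : FinQ W) (f : B → C) :
    FinQ {s : ℕ → C | ∃ t ∈ W, s = fun n => f (t n)} := by
  obtain ⟨Q, _, fam, step, q0, hs, rfl⟩ := h
  refine ⟨Set Q, inferInstance,
    fun Z => {s : ℕ → C | ∃ q ∈ Z, ∃ t ∈ fam q, s = fun n => f (t n)},
    fun Z c => {q' | ∃ q ∈ Z, ∃ a, f a = c ∧ q' = step q a}, {q0}, ?_, ?_⟩
  · intro Z c s
    constructor
    · rintro ⟨q, hq, t, ht, hst⟩
      rw [scons_eta t] at ht hst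
      rw [comp_scons, scons_inj] at hst
      exact ⟨step q (t 0), ⟨q, hq, t 0, hst.1.symm, rfl⟩, _, (hs _ _ _).1 ht, hst.2⟩
    · rintro ⟨_, ⟨q, hq, a, rfl, rfl⟩, t, ht, rfl⟩
      refine ⟨q, hq, scons a t, (hs _ _ _).2 ht, ?_⟩
      rw [comp_scons]
  · ext s; simp

theorem FinQ.exists_pred {B : Type} (p : B → Prop) : FinQ {s : ℕ → B | ∃ n, p (s n)} := by
  have := FinQ.of_fam (B := B) (Q := Bool)
    (fun q => if q then {s : ℕ → B | ∃ n, p (s n)} else Set.univ) ?_ true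
  · simpa using this
  · intro q a
    cases q
    · exact ⟨false, by simp⟩
    · by_cases ha : p a
      · refine ⟨false, fun s => ?_⟩
        simp only [if_true, Set.mem_ofPred_eq]
        exact ⟨fun _ => by simp, fun _ => ⟨0, ha⟩⟩
      · refine ⟨true, fun s => ?_⟩
        simp only [if_true, Set.mem_ofPred_eq]
        constructor
        · rintro ⟨n, hn⟩
          cases n with
          | zero => exact absurd hn ha
          | succ n => exact ⟨n, hn⟩
        · rintro ⟨n, hn⟩; exact ⟨n + 1, hn⟩

theorem FinQ.head_pred {B : Type} (p : B → Prop) : FinQ {s : ℕ → B | p (s 0)} := by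
  have := FinQ.of_fam (B := B) (Q := Option Bool)
    (fun q => match q with
      | none => {s : ℕ → B | p (s 0)}
      | some true => Set.univ
      | some false => ∅) ?_ none
  · exact this
  · intro q a
    match q with
    | some true => exact ⟨some true, by simp⟩
    | some false => exact ⟨some false, by simp⟩
    | none =>
      by_cases ha : p a
      · exact ⟨some true, fun s => by simp [scons, ha]⟩
      · exact ⟨some false, fun s => by simp [scons, ha]⟩

/-- Prepend a list. -/
def sapp {B : Type} : List B → (ℕ → B) → (ℕ → B)
  | [], s => s
  | a :: x, s => scons a (sapp x s)

theorem sapp_mem {B Q : Type} {fam : Q → Set (ℕ → B)} {step : Q → B → Q}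
    (hs : ∀ q a s, scons a s ∈ fam q ↔ s ∈ fam (step q a)) (x : List B) (q : Q) (s : ℕ → B) :
    sapp x s ∈ fam q ↔ s ∈ fam (x.foldl step q) := by
  induction x generalizing q with
  | nil => rfl
  | cons a x ih => simp only [sapp, hs, ih, List.foldl_cons]

theorem sapp_apply {B : Type} (x : List B) (s : ℕ → B) (m : ℕ) :
    sapp x s m = if h : m < x.length then x[m] else s (m - x.length) := by
  induction x generalizing m with
  | nil => simp [sapp]
  | cons a x ih =>
    cases m with
    | zero => simp [sapp, scons]
    | succ m => simp [sapp, scons, ih]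

/-- Block decoding is continuous with finite derivatives. -/
theorem FinQ.unblock {B C : Type} {W : Set (ℕ → C)} (h : FinQ W) (n : ℕ) (g : B → ℕ → C) :
    FinQ {s : ℕ → B | (fun m => g (s (m / (n + 1))) (m % (n + 1))) ∈ W} := by
  obtain ⟨Q, _, fam, step, q0, hs, rfl⟩ := h
  refine ⟨Q, inferInstance,
    fun q => {s : ℕ → B | (fun m => g (s (m / (n + 1))) (m % (n + 1))) ∈ fam q},
    fun q a => (List.ofFn (fun k : Fin (n + 1) => g a k)).foldl step q, q0, ?_, rfl⟩
  intro q a s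
  simp only [Set.mem_ofPred_eq]
  rw [← sapp_mem hs]
  have : (fun m => g (scons a s (m / (n + 1))) (m % (n + 1))) =
      sapp (List.ofFn (fun k : Fin (n + 1) => g a k))
        (fun m => g (s (m / (n + 1))) (m % (n + 1))) := by
    funext m
    rw [sapp_apply]
    by_cases hm : m < n + 1
    · rw [dif_pos (by rw [List.length_ofFn]; exact hm), List.getElem_ofFn,
        Nat.div_eq_of_lt hm, Nat.mod_eq_of_lt hm]
      rfl
    · rw [dif_neg (by rw [List.length_ofFn]; exact hm), List.length_ofFn]
      obtain ⟨k, rfl⟩ := Nat.exists_eq_add_of_le (not_lt.1 hm)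
      rw [Nat.add_div_left _ (Nat.succ_pos n), Nat.add_mod_left, Nat.add_sub_cancel_left]
      rfl
  rw [this]

/-! ### Words as streams -/

/-- The padded stream of a word. -/
def str {E : Type} (u : List E) : ℕ → Option E := fun n => u[n]?

theorem str_nil {E : Type} : str ([] : List E) = fun _ => none := by
  funext n; simp [str]

theorem str_cons {E : Type} (a : E) (u : List E) : str (a :: u) = scons (some a) (str u) := by
  funext n; cases n <;> simp [str, scons]

theorem str_inj {E : Type} {u v : List E} (h : str u = str v) : u = v :=
  List.ext_getElem? fun n => congrFun h n

theorem scons_none {E : Type} {a : Option E} {s : ℕ → Option E} :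
    scons a s = (fun _ => none) ↔ a = none ∧ s = fun _ => none := by
  have : (fun _ : ℕ => (none : Option E)) = scons none (fun _ => none) := by
    funext n; cases n <;> rfl
  rw [this, scons_inj, ← this]

/-- The padded stream of a pair of words. -/
def str2 {E : Type} (u v : List E) : ℕ → Option E × Option E := fun n => (u[n]?, v[n]?)

theorem str2_inj {E : Type} {u v u' v' : List E} (h : str2 u v = str2 u' v') :
    u = u' ∧ v = v' :=
  ⟨List.ext_getElem? fun n => congrArg Prod.fst (congrFun h n),
   List.ext_getElem? fun n => congrArg Prod.snd (congrFun h n)⟩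

/-- Regular word languages via streams. -/
def Reg1 {E : Type} (L : Set (List E)) : Prop := FinQ {s | ∃ u ∈ L, s = str u}

/-- Synchronously regular relations via streams. -/
def Reg2 {E : Type} (R : Set (List E × List E)) : Prop :=
  FinQ {s | ∃ p ∈ R, s = str2 p.1 p.2}

theorem Reg1.of_regular {E : Type} {L : Set (List E)} (h : IsRegularSet L) : Reg1 L := by
  obtain ⟨σ, _, M, hM⟩ := h
  have hL : L = {u | M.evalFrom M.start u ∈ M.accept} := by
    rw [show L = M.accepts from hM.symm]; rfl
  have := FinQ.of_fam (B := Option E) (Q := Option (Option σ))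
    (fun q => match q with
      | none => ∅
      | some none => {fun _ => none}
      | some (some q) => {s | ∃ u, M.evalFrom q u ∈ M.accept ∧ s = str u}) ?_ (some (some M.start))
  · rw [hL]; exact this
  · intro q a
    match q, a with
    | none, _ => exact ⟨none, by simp⟩
    | some none, none => exact ⟨some none, fun s => by simp [scons_none]⟩
    | some none, some a => exact ⟨none, fun s => by simp [scons_none]⟩
    | some (some q), some a =>
      refine ⟨some (some (M.step q a)), fun s => ?_⟩
      simp only [Set.mem_ofPred_eq]
      constructor
      · rintro ⟨u, hu, h⟩
        cases u with
        | nil => rw [str_nil, scons_none] at h; simp at h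
        | cons b u =>
          rw [str_cons, scons_inj] at h
          obtain ⟨h1, rfl⟩ := h
          cases h1
          exact ⟨u, hu, rfl⟩
      · rintro ⟨u, hu, rfl⟩
        exact ⟨a :: u, hu, by rw [str_cons]⟩
    | some (some q), none =>
      by_cases hq : q ∈ M.accept
      · refine ⟨some none, fun s => ?_⟩
        simp only [Set.mem_ofPred_eq, Set.mem_singleton_iff]
        constructor
        · rintro ⟨u, hu, h⟩
          cases u with
          | nil => rw [str_nil, scons_none] at h; exact h.2
          | cons b u => rw [str_cons, scons_inj] at h; simp at h
        · rintro rfl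
          exact ⟨[], hq, by rw [str_nil, scons_none]; simp⟩
      · refine ⟨none, fun s => ?_⟩
        simp only [Set.mem_ofPred_eq, Set.mem_empty_iff_false, iff_false]
        rintro ⟨u, hu, h⟩
        cases u with
        | nil => exact hq hu
        | cons b u => rw [str_cons, scons_inj] at h; simp at h

theorem Reg1.regular {E : Type} {L : Set (List E)} (h : Reg1 L) : IsRegularSet L := by
  obtain ⟨Q, _, fam, step, q0, hs, hW⟩ := h
  have : Fintype Q := Fintype.ofFinite Q
  refine ⟨Q, this, ⟨fun q a => step q (some a), q0, {q | (fun _ => none) ∈ fam q}⟩, ?_⟩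
  ext w
  have key : ∀ (w : List E) q, str w ∈ fam q ↔
      (fun _ => none) ∈ fam (w.foldl (fun q a => step q (some a)) q) := by
    intro w
    induction w with
    | nil => intro q; rw [str_nil]; rfl
    | cons a w ih => intro q; rw [str_cons, hs, ih]; rfl
  show (fun _ => none) ∈ fam (w.foldl (fun q a => step q (some a)) q0) ↔ w ∈ L
  rw [← key, hW]
  constructor
  · rintro ⟨u, hu, h⟩; rw [str_inj h]; exact hu
  · intro hw; exact ⟨w, hw, rfl⟩

theorem delta_getElem? {V E : Type} (etgt : E → V) (u v : List E) (n : ℕ) :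
    (deltaPair etgt u v)[n]? =
      match u[n]?, v[n]? with
      | some a, some b => some (Sum.inl a, Sum.inl b)
      | some a, none => some (Sum.inl a, padSym etgt v)
      | none, some b => some (padSym etgt u, Sum.inl b)
      | none, none => none := by
  unfold deltaPair
  rw [List.getElem?_append]
  by_cases h1 : n < u.length <;> by_cases h2 : n < v.length
  · simp [h1, h2]
  · have h3 : ¬ u.length ≤ v.length := by omega
    have h4 : v.length + (n - v.length) = n := by omega
    simp [h1, h2, h3, h4, min_eq_right (not_le.1 h3).le]
  · have h3 : u.length ≤ v.length := by omega
    have h4 : u.length + (n - u.length) = n := by omega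
    simp [h1, h2, h3, h4]
  · have h1' := not_lt.1 h1
    have h2' := not_lt.1 h2
    by_cases h3 : u.length ≤ v.length
    · have h4 : u.length + (n - u.length) = n := by omega
      simp [h1, h2, h3, h4, h1', h2']
    · have h4 : v.length + (n - v.length) = n := by omega
      simp [h1, h2, h3, h4, h1', h2', min_eq_right (not_le.1 h3).le]

theorem Reg2.of_sync {V E : Type} {etgt : E → V} {R : Set (List E × List E)}
    (h : SyncRegular etgt R) : Reg2 R := by
  have h1 := FinQ.image (Reg1.of_regular h)
    (fun x : Option ((E ⊕ Option V) × (E ⊕ Option V)) =>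
      ((x.bind fun y => y.1.getLeft?), (x.bind fun y => y.2.getLeft?)))
  unfold Reg2
  convert h1 using 1
  have key : ∀ u v : List E, str2 u v = fun n =>
      ((str (deltaPair etgt u v) n).bind (fun y => y.1.getLeft?),
        (str (deltaPair etgt u v) n).bind (fun y => y.2.getLeft?)) := by
    intro u v
    funext n
    simp only [str, str2, delta_getElem?]
    cases u[n]? <;> cases v[n]? <;> simp [padSym]
  ext s
  constructor
  · rintro ⟨p, hp, rfl⟩
    exact ⟨_, ⟨_, ⟨p, hp, rfl⟩, rfl⟩, key _ _⟩
  · rintro ⟨_, ⟨_, ⟨p, hp, rfl⟩, rfl⟩, rfl⟩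
    exact ⟨p, hp, (key _ _).symm⟩

theorem Reg2.sync {E : Type} {etgt : E → Unit} {R : Set (List E × List E)}
    (h : Reg2 R) (hne : ∀ p ∈ R, p.1 ≠ [] ∧ p.2 ≠ []) : SyncRegular etgt R := by
  apply Reg1.regular
  have h1 := FinQ.image h
    (fun x : Option E × Option E =>
      (match x.1, x.2 with
      | some a, some b => some (Sum.inl a, Sum.inl b)
      | some a, none => some (Sum.inl a, Sum.inr (some ()))
      | none, some b => some (Sum.inr (some ()), Sum.inl b)
      | none, none => none : Option ((E ⊕ Option Unit) × (E ⊕ Option Unit))))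
  unfold Reg1
  convert h1 using 1
  have hpad : ∀ u : List E, u ≠ [] → padSym etgt u = Sum.inr (some ()) := by
    intro u hu
    simp [padSym, List.getLast?_eq_some_getLast hu]
  have key : ∀ p ∈ R, str (deltaPair etgt p.1 p.2) = fun n =>
      (match (str2 p.1 p.2 n).1, (str2 p.1 p.2 n).2 with
      | some a, some b => some (Sum.inl a, Sum.inl b)
      | some a, none => some (Sum.inl a, Sum.inr (some ()))
      | none, some b => some (Sum.inr (some ()), Sum.inl b)
      | none, none => none : Option ((E ⊕ Option Unit) × (E ⊕ Option Unit))) := by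
    intro p hp
    funext n
    simp only [str, str2, delta_getElem?, hpad _ (hne p hp).1, hpad _ (hne p hp).2]
  ext s
  constructor
  · rintro ⟨_, ⟨p, hp, rfl⟩, rfl⟩
    exact ⟨_, ⟨p, hp, rfl⟩, key p hp⟩
  · rintro ⟨_, ⟨p, hp, rfl⟩, rfl⟩
    exact ⟨_, ⟨p, hp, rfl⟩, (key p hp).symm⟩

/-! ### Closure properties of regular languages and relations -/

theorem Reg1.inter {E : Type} {L L' : Set (List E)} (h : Reg1 L) (h' : Reg1 L') :
    Reg1 (L ∩ L') := by
  unfold Reg1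
  convert FinQ.inter h h' using 1
  ext s
  constructor
  · rintro ⟨u, hu, rfl⟩; exact ⟨⟨u, hu.1, rfl⟩, ⟨u, hu.2, rfl⟩⟩
  · rintro ⟨⟨u, hu, rfl⟩, ⟨v, hv, h⟩⟩
    have := str_inj h; subst this
    exact ⟨u, ⟨hu, hv⟩, rfl⟩

theorem Reg1.inter_stream {E : Type} {L : Set (List E)} {W : Set (ℕ → Option E)}
    (h : Reg1 L) (h' : FinQ W) : Reg1 {u | u ∈ L ∧ str u ∈ W} := by
  unfold Reg1
  convert FinQ.inter h h' using 1
  ext s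
  constructor
  · rintro ⟨u, hu, rfl⟩; exact ⟨⟨u, hu.1, rfl⟩, hu.2⟩
  · rintro ⟨⟨u, hu, rfl⟩, h⟩
    exact ⟨u, ⟨hu, h⟩, rfl⟩

theorem Reg1.diff {E : Type} {L L' : Set (List E)} (h : Reg1 L) (h' : Reg1 L') :
    Reg1 {u | u ∈ L ∧ u ∉ L'} := by
  convert h.inter_stream h'.compl using 1
  ext u
  refine and_congr_right fun _ => not_congr ⟨fun h => ⟨u, h, rfl⟩, ?_⟩
  rintro ⟨v, hv, h⟩
  rwa [str_inj h]

theorem Reg1.iUnion {E ι : Type} [Finite ι] {L : ι → Set (List E)} (h : ∀ i, Reg1 (L i)) :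
    Reg1 (⋃ i, L i) := by
  unfold Reg1
  convert FinQ.iUnion h using 1
  ext s; simp only [Set.mem_iUnion, Set.mem_ofPred_eq]
  constructor
  · rintro ⟨u, ⟨i, hu⟩, rfl⟩; exact ⟨i, u, hu, rfl⟩
  · rintro ⟨i, u, hu, rfl⟩; exact ⟨u, ⟨i, hu⟩, rfl⟩

theorem Reg2.iUnion {E ι : Type} [Finite ι] {L : ι → Set (List E × List E)}
    (h : ∀ i, Reg2 (L i)) : Reg2 (⋃ i, L i) := by
  unfold Reg2
  convert FinQ.iUnion h using 1
  ext s; simp only [Set.mem_iUnion, Set.mem_ofPred_eq]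
  constructor
  · rintro ⟨u, ⟨i, hu⟩, rfl⟩; exact ⟨i, u, hu, rfl⟩
  · rintro ⟨i, u, hu, rfl⟩; exact ⟨u, ⟨i, hu⟩, rfl⟩

theorem Reg2.empty {E : Type} : Reg2 (∅ : Set (List E × List E)) := by
  unfold Reg2
  convert FinQ.empty using 1
  ext s; simp

theorem Reg2.prod {E : Type} {L L' : Set (List E)} (h : Reg1 L) (h' : Reg1 L') :
    Reg2 (L ×ˢ L') := by
  unfold Reg2
  convert FinQ.inter (FinQ.preimage h (Prod.fst : Option E × Option E → _))
    (FinQ.preimage h' (Prod.snd : Option E × Option E → _)) using 1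
  ext s
  constructor
  · rintro ⟨p, hp, rfl⟩; exact ⟨⟨p.1, hp.1, rfl⟩, ⟨p.2, hp.2, rfl⟩⟩
  · rintro ⟨⟨u, hu, h1⟩, ⟨v, hv, h2⟩⟩
    refine ⟨(u, v), ⟨hu, hv⟩, ?_⟩
    funext n
    exact Prod.ext (congrFun h1 n) (congrFun h2 n)

theorem Reg2.inter {E : Type} {R R' : Set (List E × List E)} (h : Reg2 R) (h' : Reg2 R') :
    Reg2 (R ∩ R') := by
  unfold Reg2
  convert FinQ.inter h h' using 1
  ext s
  constructor
  · rintro ⟨u, hu, rfl⟩; exact ⟨⟨u, hu.1, rfl⟩, ⟨u, hu.2, rfl⟩⟩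
  · rintro ⟨⟨u, hu, rfl⟩, ⟨v, hv, h⟩⟩
    have := Prod.ext (str2_inj h).1 (str2_inj h).2; subst this
    exact ⟨u, ⟨hu, hv⟩, rfl⟩

theorem Reg2.inter_stream {E : Type} {R : Set (List E × List E)}
    {W : Set (ℕ → Option E × Option E)}
    (h : Reg2 R) (h' : FinQ W) : Reg2 {p | p ∈ R ∧ str2 p.1 p.2 ∈ W} := by
  unfold Reg2
  convert FinQ.inter h h' using 1
  ext s
  constructor
  · rintro ⟨u, hu, rfl⟩; exact ⟨⟨u, hu.1, rfl⟩, hu.2⟩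
  · rintro ⟨⟨u, hu, rfl⟩, h⟩
    exact ⟨u, ⟨hu, h⟩, rfl⟩

theorem Reg2.fst {E : Type} {R : Set (List E × List E)} (h : Reg2 R) :
    Reg1 {u | ∃ v, (u, v) ∈ R} := by
  unfold Reg1
  convert FinQ.image h Prod.fst using 1
  ext s
  constructor
  · rintro ⟨u, ⟨v, hv⟩, rfl⟩; exact ⟨_, ⟨_, hv, rfl⟩, rfl⟩
  · rintro ⟨_, ⟨⟨u, v⟩, hv, rfl⟩, rfl⟩; exact ⟨u, ⟨v, hv⟩, rfl⟩

theorem Reg2.comp {E : Type} {R R' : Set (List E × List E)} (h : Reg2 R) (h' : Reg2 R') :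
    Reg2 {p | ∃ v, (p.1, v) ∈ R ∧ (v, p.2) ∈ R'} := by
  unfold Reg2
  convert FinQ.image (FinQ.inter
    (FinQ.preimage h (fun x : Option E × Option E × Option E => (x.1, x.2.1)))
    (FinQ.preimage h' (fun x : Option E × Option E × Option E => (x.2.1, x.2.2))))
    (fun x => (x.1, x.2.2)) using 1
  ext s
  constructor
  · rintro ⟨⟨u, w⟩, ⟨v, h1, h2⟩, rfl⟩
    exact ⟨fun n => (u[n]?, v[n]?, w[n]?), ⟨⟨_, h1, rfl⟩, ⟨_, h2, rfl⟩⟩, rfl⟩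
  · rintro ⟨t, ⟨⟨⟨u, v⟩, h1, e1⟩, ⟨⟨v', w⟩, h2, e2⟩⟩, rfl⟩
    have hv : v = v' := List.ext_getElem? fun n =>
      (congrArg Prod.snd (congrFun e1 n)).symm.trans (congrArg Prod.fst (congrFun e2 n))
    subst hv
    refine ⟨(u, w), ⟨v, h1, h2⟩, ?_⟩
    funext n
    have a1 : (t n).1 = u[n]? := congrArg Prod.fst (congrFun e1 n)
    have a2 : (t n).2.2 = w[n]? := congrArg Prod.snd (congrFun e2 n)
    exact Prod.ext a1 a2

/-! ### Block encoding of words -/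

/-- Blocks: words of length at most `n + 1`. -/
abbrev Blk (E : Type) (n : ℕ) : Type := { l : List E // l.length ≤ n + 1 }

/-- The left context of a letter. -/
abbrev Lft (E I : Type) (n : ℕ) : Type := I ⊕ Blk E n

/-- Letters of the new alphabet (`none` is a letter for zero). -/
abbrev Let (E I Λ : Type) (n : ℕ) : Type := Option (Lft E I n × Blk E n × Option Λ)

/-- The first block. -/
def tk {E : Type} (n : ℕ) (u : List E) : Blk E n := ⟨u.take (n + 1), List.length_take_le _ _⟩

/-- The encoding. -/
def enc {E I Λ : Type} (n : ℕ) (lam : Λ) (ℓ : Lft E I n) (u : List E) : List (Let E I Λ n) :=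
  if u.length ≤ n + 1 then [some (ℓ, tk n u, some lam)]
  else some (ℓ, tk n u, none) :: enc n lam (Sum.inr (tk n u)) (u.drop (n + 1))
termination_by u.length
decreasing_by simp; omega

theorem enc_short {E I Λ : Type} {n : ℕ} (lam : Λ) (ℓ : Lft E I n) {u : List E}
    (h : u.length ≤ n + 1) : enc n lam ℓ u = [some (ℓ, tk n u, some lam)] := by
  rw [enc, if_pos h]

theorem enc_long {E I Λ : Type} {n : ℕ} (lam : Λ) (ℓ : Lft E I n) {u : List E}
    (h : ¬ u.length ≤ n + 1) : enc n lam ℓ u =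
      some (ℓ, tk n u, none) :: enc n lam (Sum.inr (tk n u)) (u.drop (n + 1)) := by
  rw [enc, if_neg h]

theorem enc_ne_nil {E I Λ : Type} {n : ℕ} (lam : Λ) (ℓ : Lft E I n) (u : List E) :
    enc n lam ℓ u ≠ [] := by
  by_cases h : u.length ≤ n + 1
  · simp [enc_short lam ℓ h]
  · simp [enc_long lam ℓ h]

/-- The content of a letter. -/
def content {E I Λ : Type} {n : ℕ} : Option (Let E I Λ n) → List E
  | some (some (_, b, _)) => b.1
  | _ => []

theorem content_enc {E I Λ : Type} {n : ℕ} (lam : Λ) (ℓ : Lft E I n) (u : List E) (m : ℕ) :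
    (content ((enc n lam ℓ u)[m / (n + 1)]?))[m % (n + 1)]? = u[m]? := by
  induction hk : u.length using Nat.strong_induction_on generalizing ℓ u m with
  | _ k ih =>
  subst hk
  by_cases h : u.length ≤ n + 1
  · rw [enc_short lam ℓ h]
    by_cases hm : m < n + 1
    · rw [Nat.div_eq_of_lt hm, Nat.mod_eq_of_lt hm]
      simp [content, tk, List.take_of_length_le h]
    · obtain ⟨k, rfl⟩ := Nat.exists_eq_add_of_le (not_lt.1 hm)
      rw [Nat.add_div_left _ (Nat.succ_pos n)]
      have : u.length ≤ n + 1 + k := by omega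
      simp [content, this]
  · rw [enc_long lam ℓ h]
    by_cases hm : m < n + 1
    · rw [Nat.div_eq_of_lt hm, Nat.mod_eq_of_lt hm]
      simp [content, tk, List.getElem?_take, hm]
    · obtain ⟨k, rfl⟩ := Nat.exists_eq_add_of_le (not_lt.1 hm)
      rw [Nat.add_div_left _ (Nat.succ_pos n), Nat.add_mod_left]
      have := ih (u.drop (n + 1)).length (by simp; omega) (Sum.inr (tk n u)) (u.drop (n + 1)) k rfl
      simpa using this

instance {E : Type} [Finite E] (n : ℕ) : Finite (Blk E n) :=
  (List.finite_length_le E (n + 1)).to_subtype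

theorem tk_append {E : Type} {n : ℕ} (b : Blk E n) (hb : b.1.length = n + 1) (u : List E) :
    tk n (b.1 ++ u) = b := by
  apply Subtype.ext
  simp [tk, ← hb]

theorem FinQ.enc {E I Λ : Type} [Finite E] [Finite I] (n : ℕ) (lam : Λ) (ℓ : Lft E I n) :
    FinQ {s | ∃ u : List E, u ≠ [] ∧ s = str (enc n lam ℓ u)} := by
  have := FinQ.of_fam (B := Option (Let E I Λ n)) (Q := Option (Option (Lft E I n)))
    (fun q => match q with
      | none => ∅
      | some none => {fun _ => none}
      | some (some ℓ) => {s | ∃ u : List E, u ≠ [] ∧ s = str (AutoRees.enc n lam ℓ u)}) ?_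
      (some (some ℓ))
  · exact this
  clear ℓ
  intro q a
  match q, a with
  | none, _ => exact ⟨none, by simp⟩
  | some none, none => exact ⟨some none, fun s => by simp [scons_none]⟩
  | some none, some a => exact ⟨none, fun s => by simp [scons_none]⟩
  | some (some ℓ), a =>
    have key : ∀ s, (∃ u : List E, u ≠ [] ∧ scons a s = str (AutoRees.enc n lam ℓ u)) ↔
      (∃ u : List E, u ≠ [] ∧ u.length ≤ n + 1 ∧ a = some (some (ℓ, tk n u, some lam)) ∧
        s = fun _ => none) ∨
      (∃ u : List E, ¬ u.length ≤ n + 1 ∧ a = some (some (ℓ, tk n u, none)) ∧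
        s = str (AutoRees.enc n lam (Sum.inr (tk n u)) (u.drop (n + 1)))) := by
      intro s
      constructor
      · rintro ⟨u, hu, h⟩
        by_cases hl : u.length ≤ n + 1
        · rw [enc_short lam ℓ hl, str_cons, scons_inj, str_nil] at h
          exact Or.inl ⟨u, hu, hl, h⟩
        · rw [enc_long lam ℓ hl, str_cons, scons_inj] at h
          exact Or.inr ⟨u, hl, h⟩
      · rintro (⟨u, hu, hl, rfl, rfl⟩ | ⟨u, hl, rfl, rfl⟩)
        · exact ⟨u, hu, by rw [enc_short lam ℓ hl, str_cons, str_nil]⟩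
        · exact ⟨u, by rintro rfl; simp at hl, by rw [enc_long lam ℓ hl, str_cons]⟩
    simp only [Set.mem_ofPred_eq]
    by_cases h1 : ∃ u : List E, u ≠ [] ∧ u.length ≤ n + 1 ∧ a = some (some (ℓ, tk n u, some lam))
    · refine ⟨some none, fun s => ?_⟩
      rw [key]
      obtain ⟨u, hu, hl, rfl⟩ := h1
      constructor
      · rintro (⟨_, _, _, _, h⟩ | ⟨_, _, h, _⟩)
        · exact h
        · simp at h
      · intro h
        exact Or.inl ⟨u, hu, hl, rfl, h⟩
    · by_cases h2 : ∃ b : Blk E n, b.1.length = n + 1 ∧ a = some (some (ℓ, b, none))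
      · obtain ⟨b, hb, rfl⟩ := h2
        refine ⟨some (some (Sum.inr b)), fun s => ?_⟩
        rw [key]
        simp only [Set.mem_ofPred_eq]
        constructor
        · rintro (⟨u, _, _, h, _⟩ | ⟨u, hu, h, rfl⟩)
          · simp at h
          · simp only [Option.some.injEq, Prod.mk.injEq, true_and, and_true] at h
            subst h
            refine ⟨u.drop (n + 1), ?_, rfl⟩
            simp; omega
        · rintro ⟨u, hu, rfl⟩
          have : 0 < u.length := List.length_pos_iff.2 hu
          refine Or.inr ⟨b.1 ++ u, by simp; omega, by rw [tk_append b hb], ?_⟩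
          rw [tk_append b hb, List.drop_append_of_le_length hb.ge]
          simp [← hb]
      · refine ⟨none, fun s => ?_⟩
        rw [key]
        simp only [Set.mem_empty_iff_false, iff_false]
        rintro (⟨u, a1, a2, a3, _⟩ | ⟨u, hu, h, _⟩)
        · exact h1 ⟨u, a1, a2, a3⟩
        · exact h2 ⟨tk n u, by simp [tk]; omega, h⟩

theorem Reg2.enc {E I Λ : Type} [Finite E] [Finite I] (n : ℕ) (i j : I) (lam mu : Λ)
    {R : Set (List E × List E)} (h : Reg2 R) (hne : ∀ p ∈ R, p.1 ≠ [] ∧ p.2 ≠ []) :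
    Reg2 {p : List (Let E I Λ n) × List (Let E I Λ n) |
      ∃ u v, (u, v) ∈ R ∧ p.1 = enc n lam (Sum.inl i) u ∧ p.2 = enc n mu (Sum.inl j) v} := by
  have h0 := (((FinQ.enc n lam (Sum.inl i : Lft E I n)).preimage
    (Prod.fst : Option (Let E I Λ n) × Option (Let E I Λ n) → _)).inter
    ((FinQ.enc n mu (Sum.inl j : Lft E I n)).preimage
    (Prod.snd : Option (Let E I Λ n) × Option (Let E I Λ n) → _))).inter
    (h.unblock n (fun (x : Option (Let E I Λ n) × Option (Let E I Λ n)) k =>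
      ((content x.1)[k]?, (content x.2)[k]?)))
  unfold Reg2
  convert h0 using 1
  have key : ∀ u v, (fun m => ((content ((str2 (AutoRees.enc n lam (Sum.inl i : Lft E I n) u)
      (AutoRees.enc n mu (Sum.inl j : Lft E I n) v)) (m / (n + 1))).1)[m % (n + 1)]?,
      (content ((str2 (AutoRees.enc n lam (Sum.inl i : Lft E I n) u)
      (AutoRees.enc n mu (Sum.inl j : Lft E I n) v)) (m / (n + 1))).2)[m % (n + 1)]?)) =
      str2 u v := by
    intro u v
    funext m
    simp only [str2, content_enc]
  ext s
  constructor
  · rintro ⟨⟨_, _⟩, ⟨u, v, huv, rfl, rfl⟩, rfl⟩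
    refine ⟨⟨⟨u, (hne _ huv).1, rfl⟩, ⟨v, (hne _ huv).2, rfl⟩⟩, ⟨(u, v), huv, key u v⟩⟩
  · rintro ⟨⟨⟨u, hu, h1⟩, ⟨v, hv, h2⟩⟩, ⟨⟨u', v'⟩, huv, h3⟩⟩
    have hs : s = str2 (AutoRees.enc n lam (Sum.inl i : Lft E I n) u)
      (AutoRees.enc n mu (Sum.inl j : Lft E I n) v) := by
      funext m
      exact Prod.ext (congrFun h1 m) (congrFun h2 m)
    subst hs
    rw [key] at h3
    obtain ⟨rfl, rfl⟩ := str2_inj h3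
    exact ⟨(_, _), ⟨u, v, huv, rfl, rfl⟩, rfl⟩

theorem Reg1.enc {E I Λ : Type} [Finite E] [Finite I] (n : ℕ) (i : I) (lam : Λ)
    {L : Set (List E)} (h : Reg1 L) (hne : ∀ u ∈ L, u ≠ []) :
    Reg1 {w : List (Let E I Λ n) | ∃ u ∈ L, w = enc n lam (Sum.inl i) u} := by
  have := (Reg2.enc (I := I) n i i lam lam (Reg2.prod h h)
    (fun p hp => ⟨hne _ hp.1, hne _ hp.2⟩)).fst
  convert this using 1
  ext w
  constructor
  · rintro ⟨u, hu, rfl⟩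
    exact ⟨_, u, u, ⟨hu, hu⟩, rfl, rfl⟩
  · rintro ⟨_, u, v, ⟨hu, hv⟩, rfl, _⟩
    exact ⟨u, hu, rfl⟩

theorem Reg1.singleton {E : Type} (a : E) : Reg1 {[a]} := by
  have := FinQ.of_fam (B := Option E) (Q := Option Bool)
    (fun q => match q with
      | none => {str [a]}
      | some true => {fun _ => none}
      | some false => ∅) ?_ none
  · unfold Reg1; simpa using this
  · intro q b
    match q, b with
    | some false, _ => exact ⟨some false, by simp⟩
    | some true, none => exact ⟨some true, fun s => by simp [scons_none]⟩
    | some true, some b => exact ⟨some false, fun s => by simp [scons_none]⟩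
    | none, b =>
      by_cases hb : b = some a
      · exact ⟨some true, fun s => by simp [str_cons, scons_inj, str_nil, hb]⟩
      · exact ⟨some false, fun s => by simp [str_cons, scons_inj, hb]⟩

/-! ### Evaluation of paths -/

/-- `l` is a path starting at the vertex `x`. -/
def Ch {O E : Type} (esrc etgt : E → O) : O → List E → Prop
  | _, [] => True
  | x, e :: l => x = esrc e ∧ Ch esrc etgt (etgt e) l

theorem chain_iff {O E : Type} (esrc etgt : E → O) (e : E) (l : List E) :
    IsPathChain esrc etgt (e :: l) ↔ Ch esrc etgt (etgt e) l := by
  induction l generalizing e with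
  | nil => exact ⟨fun _ => trivial, fun _ => List.isChain_singleton _⟩
  | cons f l ih =>
    rw [Ch, ← ih f]
    exact List.isChain_cons_cons

section
variable {O A E : Type} {S : Sgpd O A} (C : ChoiceOfReps S.toPreSgpd E)

/-- Left-to-right product. -/
def fl (a : A) (l : List E) : A := (l.map C.lab).foldl S.mul a

/-- `u` is a non-empty path with value `a`. -/
def Ev (u : List E) (a : A) : Prop :=
  ∃ e l, u = e :: l ∧ Ch C.esrc C.etgt (C.etgt e) l ∧ a = fl C (C.lab e) l

theorem fl_cons (a : A) (e : E) (l : List E) : fl C a (e :: l) = fl C (S.mul a (C.lab e)) l := rfl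

theorem fl_append (a : A) (l m : List E) : fl C a (l ++ m) = fl C (fl C a l) m := by
  simp [fl]

theorem tgt_mul_lab {a : A} {e : E} (h : S.tgt a = C.esrc e) :
    S.tgt (S.mul a (C.lab e)) = C.etgt e := by
  rw [S.tgt_mul _ _ (h.trans (C.lab_src e).symm), C.lab_tgt]

theorem fl_src {a : A} {l : List E} (h : Ch C.esrc C.etgt (S.tgt a) l) :
    S.src (fl C a l) = S.src a := by
  induction l generalizing a with
  | nil => rfl
  | cons e l ih =>
    obtain ⟨h1, h2⟩ := h
    rw [fl_cons, ih, S.src_mul _ _ (h1.trans (C.lab_src e).symm)]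
    rw [tgt_mul_lab C h1]; exact h2

theorem fl_assoc {a b : A} {l : List E} (hab : S.tgt a = S.src b)
    (h : Ch C.esrc C.etgt (S.tgt b) l) : fl C (S.mul a b) l = S.mul a (fl C b l) := by
  induction l generalizing b with
  | nil => rfl
  | cons e l ih =>
    obtain ⟨h1, h2⟩ := h
    have h1' := h1.trans (C.lab_src e).symm
    rw [fl_cons, fl_cons, S.mul_assoc' _ _ _ hab h1', ih]
    · rw [S.src_mul _ _ h1']; exact hab
    · rw [tgt_mul_lab C h1]; exact h2

theorem Ch_append {a : A} {l m : List E} : Ch C.esrc C.etgt (S.tgt a) (l ++ m) ↔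
    Ch C.esrc C.etgt (S.tgt a) l ∧ Ch C.esrc C.etgt (S.tgt (fl C a l)) m := by
  induction l generalizing a with
  | nil => simp [Ch, fl]
  | cons e l ih =>
    simp only [List.cons_append, Ch, fl_cons, and_assoc]
    refine and_congr_right fun h1 => ?_
    rw [← tgt_mul_lab C h1, ih]

variable {C}

theorem Ev.ne_nil {u : List E} {a : A} (h : Ev C u a) : u ≠ [] := by
  obtain ⟨e, l, rfl, _⟩ := h; simp

theorem Ev.chain {u : List E} {a : A} (h : Ev C u a) : IsPathChain C.esrc C.etgt u := by
  obtain ⟨e, l, rfl, h, _⟩ := h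
  exact (chain_iff _ _ _ _).2 h

theorem Ev.eval {u : List E} {a : A} (h : Ev C u a) : evalPath? S.toPreSgpd C.lab u = some a := by
  obtain ⟨e, l, rfl, _, rfl⟩ := h; rfl

theorem Ev.unique {u : List E} {a b : A} (h : Ev C u a) (h' : Ev C u b) : a = b := by
  have := h.eval.symm.trans h'.eval
  exact Option.some.inj this

theorem Ev.single (e : E) : Ev C [e] (C.lab e) := ⟨e, [], rfl, trivial, rfl⟩

theorem Ev.exists {u : List E} (h : u ≠ []) (h' : IsPathChain C.esrc C.etgt u) :
    ∃ a, Ev C u a := by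
  cases u with
  | nil => exact absurd rfl h
  | cons e l => exact ⟨_, e, l, rfl, (chain_iff _ _ _ _).1 h', rfl⟩

theorem Ev.of_eval {u : List E} {a : A} (h' : IsPathChain C.esrc C.etgt u)
    (h : evalPath? S.toPreSgpd C.lab u = some a) : Ev C u a := by
  cases u with
  | nil => simp [evalPath?] at h
  | cons e l => exact ⟨e, l, rfl, (chain_iff _ _ _ _).1 h', (Option.some.inj h).symm⟩

theorem Ev.append {u v : List E} {a b : A} (hu : Ev C u a) (hv : Ev C v b)
    (h : S.tgt a = S.src b) : Ev C (u ++ v) (S.mul a b) := by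
  obtain ⟨e, l, rfl, h1, rfl⟩ := hu
  obtain ⟨f, m, rfl, h2, rfl⟩ := hv
  rw [← C.lab_tgt] at h1 h2
  rw [fl_src C h2] at h
  refine ⟨e, l ++ f :: m, rfl, ?_, ?_⟩
  · rw [← C.lab_tgt, Ch_append]
    refine ⟨h1, ?_, ?_⟩
    · rw [h, C.lab_src]
    · rw [← C.lab_tgt]; exact h2
  · rw [fl_append, fl_cons, fl_assoc C h h2]

theorem Ev.split {u v : List E} {c : A} (h : Ev C (u ++ v) c) (hu : u ≠ []) (hv : v ≠ []) :
    ∃ a b, Ev C u a ∧ Ev C v b ∧ S.tgt a = S.src b ∧ c = S.mul a b := by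
  obtain ⟨e, l, rfl⟩ := List.exists_cons_of_ne_nil hu
  obtain ⟨f, m, rfl⟩ := List.exists_cons_of_ne_nil hv
  obtain ⟨e', l', he, h1, rfl⟩ := h
  obtain ⟨rfl, rfl⟩ := List.cons.inj he
  rw [← C.lab_tgt] at h1
  change Ch _ _ _ (l ++ f :: m) at h1
  rw [Ch_append] at h1
  obtain ⟨h1, h2, h3⟩ := h1
  have h2' := h2.trans (C.lab_src f).symm
  have h3' := h3
  rw [← C.lab_tgt] at h3'
  refine ⟨_, _, ⟨e, l, rfl, by rw [← C.lab_tgt]; exact h1, rfl⟩, ⟨f, m, rfl, h3, rfl⟩, ?_, ?_⟩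
  · rw [fl_src C h3', h2']
  · show fl C _ (l ++ f :: m) = _
    rw [fl_append, fl_cons, fl_assoc C h2' h3']

theorem Ev.src {u : List E} {a : A} (h : Ev C u a) : u.head?.map C.esrc = some (S.src a) := by
  obtain ⟨e, l, rfl, h1, rfl⟩ := h
  rw [← C.lab_tgt] at h1
  simp [fl_src C h1, C.lab_src]

theorem Ev.tgt {u : List E} {a : A} (h : Ev C u a) : pathTgt? C.etgt u = some (S.tgt a) := by
  obtain ⟨e, l, rfl, h1, rfl⟩ := h
  have key : ∀ (l : List E) (e : E) (a : A), S.tgt a = C.etgt e → Ch C.esrc C.etgt (C.etgt e) l →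
      pathTgt? C.etgt (e :: l) = some (S.tgt (fl C a l)) := by
    intro l
    induction l with
    | nil => intro e a h _; simp [pathTgt?, fl, h]
    | cons f l ih =>
      intro e a h h1
      have := ih f (S.mul a (C.lab f)) (tgt_mul_lab C (h.trans h1.1)) h1.2
      rw [fl_cons, ← this]
      simp [pathTgt?]
  exact key l e _ (C.lab_tgt e) h1

/-- Replacing a factor by one with the same value. -/
theorem Ev.replace {x w w' z : List E} {a b : A} (h : Ev C (x ++ (w ++ z)) a)
    (hw : Ev C w b) (hw' : Ev C w' b) : Ev C (x ++ (w' ++ z)) a := by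
  have hz : ∀ c, Ev C (w ++ z) c → Ev C (w' ++ z) c := by
    intro c hc
    by_cases hz : z = []
    · subst hz
      rw [List.append_nil] at hc ⊢
      rw [hc.unique hw]; exact hw'
    · obtain ⟨b', d, h1, h2, h3, rfl⟩ := hc.split hw.ne_nil hz
      rw [h1.unique hw] at h3 ⊢
      exact hw'.append h2 h3
  by_cases hx : x = []
  · subst hx; exact hz a h
  · obtain ⟨b', d, h1, h2, h3, rfl⟩ := h.split hx (by simp [hw.ne_nil])
    exact h1.append (hz _ h2) h3

theorem Ev.of_mem {u : List E} (h : u ∈ C.K) : ∃ a, Ev C u a :=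
  Ev.exists (C.K_path u h).1 (C.K_path u h).2

theorem Ev.onto (a : A) : ∃ u ∈ C.K, Ev C u a := by
  obtain ⟨u, hu, h⟩ := C.K_onto a
  exact ⟨u, hu, Ev.of_eval (C.K_path u hu).2 h⟩

theorem gen_induct {p : A → Prop} (h1 : ∀ e, p (C.lab e))
    (h2 : ∀ a b, S.tgt a = S.src b → p a → p b → p (S.mul a b)) (a : A) : p a := by
  obtain ⟨u, _, e, l, rfl, hc, rfl⟩ := Ev.onto (C := C) a
  rw [← C.lab_tgt] at hc
  have key : ∀ (l : List E) (a : A), p a → Ch C.esrc C.etgt (S.tgt a) l → p (fl C a l) := by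
    intro l
    induction l with
    | nil => intro a h _; exact h
    | cons f l ih =>
      intro a h hc
      rw [fl_cons]
      apply ih _ (h2 _ _ (hc.1.trans (C.lab_src f).symm) h (h1 f))
      rw [tgt_mul_lab C hc.1]; exact hc.2
  exact key l _ (h1 e) hc

/-! ### Consequences of automaticity -/

/-- Right multiplication by an arrow, on representatives. -/
def relC (C : ChoiceOfReps S.toPreSgpd E) (c : A) : Set (List E × List E) :=
  {p | p.1 ∈ C.K ∧ p.2 ∈ C.K ∧ ∃ a, Ev C p.1 a ∧ S.tgt a = S.src c ∧ Ev C p.2 (S.mul a c)}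

theorem relC_reg (hC : IsAutomaticStructure C) (c : A) : Reg2 (relC C c) := by
  induction c using gen_induct (C := C) with
  | h1 e =>
    convert Reg2.of_sync (hC.2.2.1 e) using 1
    ext ⟨u, v⟩
    refine and_congr_right fun hu => and_congr_right fun hv => ?_
    obtain ⟨a, ha⟩ := Ev.of_mem hu
    constructor
    · rintro ⟨a, ha, h1, h2⟩
      refine ⟨?_, ?_⟩
      · rw [ha.tgt, h1, C.lab_src]
      · rw [(ha.append (Ev.single e) h1).eval, h2.eval]
    · rintro ⟨h1, h2⟩
      rw [ha.tgt, Option.some.injEq, ← C.lab_src] at h1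
      rw [(ha.append (Ev.single e) h1).eval] at h2
      exact ⟨a, ha, h1, Ev.of_eval (C.K_path v hv).2 h2.symm⟩
  | h2 c d hcd ihc ihd =>
    convert Reg2.comp ihc ihd using 1
    ext ⟨u, v⟩
    constructor
    · rintro ⟨hu, hv, a, ha, h1, h2⟩
      rw [S.src_mul _ _ hcd] at h1
      obtain ⟨w, hw, hwe⟩ := Ev.onto (C := C) (S.mul a c)
      refine ⟨w, ⟨hu, hw, a, ha, h1, hwe⟩, ⟨hw, hv, _, hwe, ?_, ?_⟩⟩
      · rw [S.tgt_mul _ _ h1]; exact hcd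
      · rw [S.mul_assoc' _ _ _ h1 hcd]; exact h2
    · rintro ⟨w, ⟨hu, hw, a, ha, h1, h2⟩, ⟨_, hv, b, hb, h3, h4⟩⟩
      have := hb.unique h2
      subst this
      refine ⟨hu, hv, a, ha, by rw [S.src_mul _ _ hcd]; exact h1, ?_⟩
      rw [← S.mul_assoc' _ _ _ h1 hcd]; exact h4

/-- The shortest representatives. -/
def K1 (C : ChoiceOfReps S.toPreSgpd E) : Set (List E) :=
  {u | u ∈ C.K ∧ ∀ v ∈ C.K, ∀ a, Ev C u a → Ev C v a → u.length ≤ v.length}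

theorem relEq_reg (hC : IsAutomaticStructure C) : Reg2 (relEq C) := by
  have := hC.1
  convert Reg2.iUnion (fun e : E => Reg2.of_sync (hC.2.2.2 (C.etgt e))) using 1
  ext ⟨u, v⟩
  simp only [Set.mem_iUnion]
  constructor
  · rintro ⟨hu, hv, h⟩
    obtain ⟨e, he⟩ : ∃ e, u.getLast? = some e :=
      ⟨_, List.getLast?_eq_some_getLast (C.K_path u hu).1⟩
    exact ⟨e, hu, hv, by simp [pathTgt?, he], h⟩
  · rintro ⟨e, hu, hv, _, h⟩
    exact ⟨hu, hv, h⟩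

theorem K1_reg (hC : IsAutomaticStructure C) : Reg1 (K1 C) := by
  have h1 := (relEq_reg hC).inter_stream
    (FinQ.exists_pred (fun x : Option E × Option E => x.1 ≠ none ∧ x.2 = none))
  convert Reg1.diff (Reg1.of_regular hC.2.1) h1.fst using 1
  ext u
  refine and_congr_right fun hu => ?_
  obtain ⟨a, ha⟩ := Ev.of_mem hu
  constructor
  · rintro h ⟨v, ⟨_, hv, he⟩, n, hn1, hn2⟩
    have hva : Ev C v a := Ev.of_eval (C.K_path v hv).2 (he.symm.trans ha.eval)
    have := h v hv a ha hva
    simp [str2] at hn1 hn2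
    omega
  · intro h v hv b hb hvb
    by_contra hlt
    apply h
    refine ⟨v, ⟨hu, hv, hb.eval.trans hvb.eval.symm⟩, v.length, ?_, ?_⟩
    · simp [str2]; omega
    · simp [str2]

theorem K1_onto (C : ChoiceOfReps S.toPreSgpd E) (a : A) : ∃ u ∈ K1 C, Ev C u a := by
  classical
  have hex : ∃ n, ∃ u ∈ C.K, Ev C u a ∧ u.length = n := by
    obtain ⟨u, hu, h⟩ := Ev.onto (C := C) a
    exact ⟨_, u, hu, h, rfl⟩
  obtain ⟨u, hu, h, hn⟩ := Nat.find_spec hex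
  refine ⟨u, ⟨hu, fun v hv b hb hvb => ?_⟩, h⟩
  rw [h.unique hb] at hex
  have := h.unique hb
  subst this
  rw [hn]
  exact Nat.find_min' _ ⟨v, hv, hvb, rfl⟩

theorem bound (hC : IsAutomaticStructure C) (T : Set A) (hT : Tᶜ.Finite)
    (hid : ∀ a ∈ T, ∀ b, S.tgt a = S.src b → S.mul a b ∈ T) :
    ∃ n, ∀ x w z, x ++ (w ++ z) ∈ K1 C → w.length = n + 1 → ∀ b, Ev C w b → b ∈ T := by
  obtain ⟨σ, _, M, hM⟩ := hC.2.1
  have hmem : ∀ u, u ∈ C.K ↔ M.eval u ∈ M.accept := by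
    intro u
    have : u ∈ M.accepts ↔ u ∈ C.K := by rw [hM]; rfl
    exact this.symm
  have hfin : Finite ↥Tᶜ := hT
  refine ⟨Nat.card (σ × ↥Tᶜ), fun x w z hK hw b hb => ?_⟩
  by_contra hbT
  set n := Nat.card (σ × ↥Tᶜ) with hn
  -- values of the prefixes
  have hpre : ∀ k : Fin (n + 1), ∃ c : ↥Tᶜ, Ev C (w.take (k + 1)) c := by
    intro k
    by_cases hk : (k : ℕ) + 1 = n + 1
    · refine ⟨⟨b, hbT⟩, ?_⟩
      rw [hk, ← hw, List.take_length]; exact hb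
    · have hk' : (k : ℕ) + 1 < w.length := by have := k.2; omega
      have hb' := hb
      rw [← List.take_append_drop (k + 1) w] at hb'
      obtain ⟨c, d, h1, h2, h3, rfl⟩ := hb'.split
        (by rw [← List.length_pos_iff]; simp; omega)
        (by rw [← List.length_pos_iff]; simp; omega)
      exact ⟨⟨c, fun hc => hbT (hid c hc d h3)⟩, h1⟩
  choose c hc using hpre
  have hinj : Function.Injective
      (fun k : Fin (n + 1) => (M.eval (x ++ w.take (k + 1)), c k)) := by
    have main : ∀ k l : Fin (n + 1), k < l →
        (M.eval (x ++ w.take (k + 1)), c k) ≠ (M.eval (x ++ w.take (l + 1)), c l) := by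
      intro k l hkl heq
      obtain ⟨h1, h2⟩ := Prod.mk.inj heq
      have e1 : x ++ (w ++ z) = x ++ (w.take (l + 1) ++ (w.drop (l + 1) ++ z)) := by
        rw [← List.append_assoc (w.take _), List.take_append_drop]
      obtain ⟨a, ha⟩ := Ev.of_mem hK.1
      have ha' := ha
      rw [e1] at ha'
      have hl := hc l
      rw [← h2] at hl
      have hnew := ha'.replace hl (hc k)
      have hnewK : x ++ (w.take (k + 1) ++ (w.drop (l + 1) ++ z)) ∈ C.K := by
        have := hK.1
        rw [e1, hmem, ← List.append_assoc] at this
        rw [hmem, ← List.append_assoc]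
        change M.evalFrom M.start _ ∈ _ at this
        change M.evalFrom M.start _ ∈ _
        rw [DFA.evalFrom_of_append] at this ⊢
        change M.evalFrom M.start _ = M.evalFrom M.start _ at h1
        rw [h1]; exact this
      have hlen := hK.2 _ hnewK a ha hnew
      have hk1 := k.2
      have hl1 := l.2
      have hkl' : (k : ℕ) < l := hkl
      simp at hlen
      omega
    intro k l h
    by_contra hne
    rcases lt_or_gt_of_ne hne with hlt | hlt
    · exact main k l hlt h
    · exact main l k hlt h.symm
  have := Nat.card_le_card_of_injective _ hinj
  rw [← hn, Nat.card_fin] at this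
  omega

end

/-! ### The Rees matrix semigroup -/

section
variable {O A I Λ : Type} {S : Sgpd O A} {R : Rees.Data0 S I Λ}

open Classical in
/-- The triple `(i, x, lam)`, or zero if it is not valid. -/
noncomputable def mkT (R : Rees.Data0 S I Λ) (i : I) (x : A) (lam : Λ) : Rees.Carrier0 S R :=
  if h : Rees.Valid S R.F R.G (i, x, lam) then some ⟨(i, x, lam), h⟩ else none

theorem mkT_valid {i : I} {x : A} {lam : Λ} (h : Rees.Valid S R.F R.G (i, x, lam)) :
    mkT R i x lam = some ⟨(i, x, lam), h⟩ := by
  exact dif_pos h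

theorem mkT_ne {i : I} {x : A} {lam : Λ} (h : Rees.Valid S R.F R.G (i, x, lam)) :
    mkT R i x lam ≠ none := by
  rw [mkT_valid h]; exact Option.some_ne_none _

theorem mkT_inj {i j : I} {x y : A} {lam mu : Λ} (h : Rees.Valid S R.F R.G (i, x, lam))
    (h' : Rees.Valid S R.F R.G (j, y, mu)) (he : mkT R i x lam = mkT R j y mu) :
    i = j ∧ x = y ∧ lam = mu := by
  rw [mkT_valid h, mkT_valid h'] at he
  have := congrArg Subtype.val (Option.some.inj he)
  simpa using this

theorem mul0_none (m : Rees.Carrier0 S R) : Rees.mul0 S R m none = none := by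
  cases m with
  | none => rfl
  | some t => obtain ⟨⟨i, x, lam⟩, h⟩ := t; rfl

theorem match_some {T : Type} (o : Option A) (c : ∀ p, o = some p → T) (p : A)
    (h : o = some p) :
    (match (generalizing := false) hp : o with
      | some p => some (c p hp)
      | none => none : Option T) = some (c p h) := by
  subst h; rfl

theorem match_none {T : Type} (o : Option A) (c : ∀ p, o = some p → T) (h : o = none) :
    (match (generalizing := false) hp : o with
      | some p => some (c p hp)
      | none => none : Option T) = none := by
  subst h; rfl

theorem mul_mkT {i j : I} {x y p : A} {lam mu : Λ} (h : Rees.Valid S R.F R.G (i, x, lam))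
    (h' : Rees.Valid S R.F R.G (j, y, mu)) (hp : R.P lam j = some p) :
    Rees.mul0 S R (mkT R i x lam) (mkT R j y mu) = mkT R i (S.mul (S.mul x p) y) mu := by
  rw [mkT_valid h, mkT_valid h',
    mkT_valid (Rees.prod_valid S h h' (R.P_src lam j p hp) (R.P_tgt lam j p hp))]
  exact match_some (T := Rees.Triples S R.F R.G) (R.P lam j)
    (fun p hp => ⟨(i, S.mul (S.mul x p) y, mu),
        Rees.prod_valid S h h' (R.P_src lam j p hp) (R.P_tgt lam j p hp)⟩) p hp

theorem mul_mkT_zero {i j : I} {x y : A} {lam mu : Λ} (h : Rees.Valid S R.F R.G (i, x, lam))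
    (h' : Rees.Valid S R.F R.G (j, y, mu)) (hp : R.P lam j = none) :
    Rees.mul0 S R (mkT R i x lam) (mkT R j y mu) = none := by
  rw [mkT_valid h, mkT_valid h']
  exact match_none (T := Rees.Triples S R.F R.G) (R.P lam j)
    (fun p hp => ⟨(i, S.mul (S.mul x p) y, mu),
        Rees.prod_valid S h h' (R.P_src lam j p hp) (R.P_tgt lam j p hp)⟩) hp

theorem mul0_some {m m' : Rees.Carrier0 S R} {t : Rees.Triples S R.F R.G}
    (h : Rees.mul0 S R m m' = some t) :
    ∃ t1 t2 : Rees.Triples S R.F R.G, m = some t1 ∧ m' = some t2 ∧ t.1.1 = t1.1.1 ∧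
      t.1.2.2 = t2.1.2.2 ∧ t.1.2.1 ∈ Rees.SPS0 S R := by
  cases m with
  | none => cases h
  | some t1 =>
    cases m' with
    | none =>
      have h4 := (mul0_none (R := R) (some t1)).symm.trans h
      cases h4
    | some t2 =>
      obtain ⟨⟨i, x, lam⟩, h1⟩ := t1
      obtain ⟨⟨j, y, mu⟩, h2⟩ := t2
      refine ⟨_, _, rfl, rfl, ?_⟩
      cases hp : R.P lam j with
      | none =>
        have := mul_mkT_zero h1 h2 hp
        rw [mkT_valid h1, mkT_valid h2] at this
        have h3 := this.symm.trans h
        cases h3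
      | some p =>
        have := mul_mkT h1 h2 hp
        rw [mkT_valid h1, mkT_valid h2,
          mkT_valid (Rees.prod_valid S h1 h2 (R.P_src lam j p hp) (R.P_tgt lam j p hp))] at this
        have h3 := Option.some.inj (this.symm.trans h)
        subst h3
        refine ⟨rfl, rfl, x, p, y, lam, j, hp, ?_, ?_, rfl⟩
        · rw [R.P_src _ _ _ hp]; exact h1.2
        · rw [R.P_tgt _ _ _ hp]; exact h2.1

theorem foldl_head (l : List (Rees.Carrier0 S R)) (m : Rees.Carrier0 S R)
    (t : Rees.Triples S R.F R.G) (h : l.foldl (Rees.mul0 S R) m = some t) :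
    ∃ t0 : Rees.Triples S R.F R.G, m = some t0 ∧ t.1.1 = t0.1.1 := by
  induction l generalizing m with
  | nil => exact ⟨t, h, rfl⟩
  | cons x l ih =>
    obtain ⟨t0, h0, h1⟩ := ih _ h
    obtain ⟨t1, t2, rfl, rfl, h2, _⟩ := mul0_some h0
    exact ⟨t1, rfl, h1.trans h2⟩

theorem fg_triple {T : Set (Rees.Carrier0 S R)}
    (hT : ∀ a : Rees.Carrier0 S R, ∃ l : List (Rees.Carrier0 S R), l ≠ [] ∧ (∀ x ∈ l, x ∈ T) ∧
      IsPathChain (Rees.pre0 S R).src (Rees.pre0 S R).tgt l ∧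
      evalPath? (Rees.pre0 S R) id l = some a)
    (t : Rees.Triples S R.F R.G) :
    (∃ t0, some t0 ∈ T ∧ t.1.1 = t0.1.1) ∧ (∃ t0, some t0 ∈ T ∧ t.1.2.2 = t0.1.2.2) ∧
    (t.1.2.1 ∈ Rees.SPS0 S R ∨ some t ∈ T) := by
  obtain ⟨l, hl, hlT, _, he⟩ := hT (some t)
  obtain ⟨x, l, rfl⟩ := List.exists_cons_of_ne_nil hl
  have he : l.foldl (Rees.mul0 S R) x = some t := by
    have := Option.some.inj he
    rw [List.map_id] at this
    exact this
  refine ⟨?_, ?_⟩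
  · obtain ⟨t0, rfl, h⟩ := foldl_head _ _ _ he
    exact ⟨t0, hlT _ List.mem_cons_self, h⟩
  · rcases List.eq_nil_or_concat l with rfl | ⟨l, z, rfl⟩
    · have he : x = some t := he
      subst he
      have := hlT (some t) List.mem_cons_self
      exact ⟨⟨t, this, rfl⟩, Or.inr this⟩
    · rw [List.concat_eq_append, List.foldl_append] at he
      obtain ⟨t1, t2, h1, rfl, _, h2, h3⟩ := mul0_some he
      exact ⟨⟨t2, hlT _ (List.mem_cons_of_mem _ (by
        have hm : ∀ z : Rees.Carrier0 S R, z ∈ l.concat z := fun z => by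
          rw [List.concat_eq_append]; exact List.mem_append_right _ List.mem_cons_self
        exact hm _)), h2⟩, Or.inl h3⟩

theorem fg_finite (hfg : IsFG (Rees.pre0 S R)) :
    Finite I ∧ Finite Λ ∧ (Rees.SPS0 S R)ᶜ.Finite := by
  obtain ⟨T, hTf, hT⟩ := hfg
  have key := fg_triple hT
  set T' : Set (Rees.Triples S R.F R.G) := {t | some t ∈ T} with hT'
  have hT'f : T'.Finite := hTf.preimage (fun a _ b _ h => Option.some.inj h)
  refine ⟨?_, ?_, ?_⟩
  · rw [← Set.finite_univ_iff]
    refine (hT'f.image (fun t => t.1.1)).subset ?_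
    intro i _
    obtain ⟨a, ha⟩ := R.F_into i
    obtain ⟨lam, hl⟩ := R.G_onto a
    obtain ⟨t0, h0, h1⟩ := (key ⟨(i, a, lam), ha.symm, hl.symm⟩).1
    exact ⟨t0, h0, h1.symm⟩
  · rw [← Set.finite_univ_iff]
    refine (hT'f.image (fun t => t.1.2.2)).subset ?_
    intro lam _
    obtain ⟨a, ha⟩ := R.G_into lam
    obtain ⟨i, hl⟩ := R.F_onto a
    obtain ⟨t0, h0, h1⟩ := (key ⟨(i, a, lam), hl, ha⟩).2.1
    exact ⟨t0, h0, h1.symm⟩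
  · refine (hT'f.image (fun t => t.1.2.1)).subset ?_
    intro a ha
    obtain ⟨i, hi⟩ := R.F_onto a
    obtain ⟨lam, hl⟩ := R.G_onto a
    rcases (key ⟨(i, a, lam), hi, hl.symm⟩).2.2 with h | h
    · exact absurd h ha
    · exact ⟨_, h, rfl⟩

theorem SPS0_ideal {a b : A} (ha : a ∈ Rees.SPS0 S R) (h : S.tgt a = S.src b) :
    S.mul a b ∈ Rees.SPS0 S R := by
  obtain ⟨s, p, t, lam, i, hp, h1, h2, rfl⟩ := ha
  have h3 : S.tgt (S.mul s p) = S.src t := by rw [S.tgt_mul _ _ h1]; exact h2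
  rw [S.tgt_mul _ _ h3] at h
  refine ⟨s, p, S.mul t b, lam, i, hp, h1, ?_, ?_⟩
  · rw [S.src_mul _ _ h]; exact h2
  · rw [S.mul_assoc' _ _ _ h3 h]

/-- A choice of decompositions of the elements of `S P S`. -/
structure Dec (R : Rees.Data0 S I Λ) where
  s : A → A
  p : A → A
  t : A → A
  l : A → Λ
  i : A → I
  hP : ∀ a ∈ Rees.SPS0 S R, R.P (l a) (i a) = some (p a)
  h1 : ∀ a ∈ Rees.SPS0 S R, S.tgt (s a) = S.src (p a)
  h2 : ∀ a ∈ Rees.SPS0 S R, S.tgt (p a) = S.src (t a)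
  h3 : ∀ a ∈ Rees.SPS0 S R, a = S.mul (S.mul (s a) (p a)) (t a)

theorem Dec.nonempty (R : Rees.Data0 S I Λ) (hne : Nonempty A) : Nonempty (Dec R) := by
  obtain ⟨a0⟩ := hne
  obtain ⟨i0, _⟩ := R.F_onto a0
  obtain ⟨l0, _⟩ := R.G_onto a0
  have : Nonempty A := ⟨a0⟩
  have : Nonempty I := ⟨i0⟩
  have : Nonempty Λ := ⟨l0⟩
  have h : ∀ a, a ∈ Rees.SPS0 S R → ∃ s p t lam i, R.P lam i = some p ∧ S.tgt s = S.src p ∧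
    S.tgt p = S.src t ∧ a = S.mul (S.mul s p) t := fun a ha => ha
  choose! s p t l i hP h1 h2 h3 using h
  exact ⟨⟨s, p, t, l, i, hP, h1, h2, h3⟩⟩

variable {E : Type} {C : ChoiceOfReps S.toPreSgpd E}

open Classical in
/-- Value of a word (junk if not a path). -/
noncomputable def vl (C : ChoiceOfReps S.toPreSgpd E) (a0 : A) (u : List E) : A :=
  if h : ∃ a, Ev C u a then h.choose else a0

theorem Ev.vl {a0 a : A} {u : List E} (h : Ev C u a) : vl C a0 u = a := by
  have hex : ∃ a, Ev C u a := ⟨a, h⟩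
  rw [AutoRees.vl, dif_pos hex]
  exact hex.choose_spec.unique h

/-- Row index carried by a left context. -/
noncomputable def lidx (C : ChoiceOfReps S.toPreSgpd E) (D : Dec R) (a0 : A) {n : ℕ} :
    Lft E I n → I
  | Sum.inl i => i
  | Sum.inr b => D.i (vl C a0 b.1)

/-- Multiplication by the element carried by a left context. -/
noncomputable def lmul (C : ChoiceOfReps S.toPreSgpd E) (D : Dec R) (a0 : A) {n : ℕ} :
    Lft E I n → A → A
  | Sum.inl _, x => x
  | Sum.inr b, x => S.mul (D.t (vl C a0 b.1)) x

/-- Labels of the new letters. -/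
noncomputable def labM (C : ChoiceOfReps S.toPreSgpd E) (D : Dec R) (a0 : A) {n : ℕ} :
    Let E I Λ n → Rees.Carrier0 S R
  | none => none
  | some (ℓ, b, none) =>
      mkT R (lidx C D a0 ℓ) (lmul C D a0 ℓ (D.s (vl C a0 b.1))) (D.l (vl C a0 b.1))
  | some (ℓ, b, some lam) => mkT R (lidx C D a0 ℓ) (lmul C D a0 ℓ (vl C a0 b.1)) lam

/-- All blocks of length `n + 1` have value in `S P S`. -/
def Good (C : ChoiceOfReps S.toPreSgpd E) (R : Rees.Data0 S I Λ) (n : ℕ) (u : List E) : Prop :=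
  ∀ x w z, u = x ++ (w ++ z) → w.length = n + 1 → ∀ b, Ev C w b → b ∈ Rees.SPS0 S R

theorem Good.drop {n : ℕ} {u : List E} (h : Good C R n u) (k : ℕ) : Good C R n (u.drop k) := by
  intro x w z hu hw b hb
  refine h (u.take k ++ x) w z ?_ hw b hb
  rw [List.append_assoc, ← hu, List.take_append_drop]

theorem assoc5 {X t s p t' a : A} (h1 : S.tgt X = S.src t) (h2 : S.tgt t = S.src s)
    (h3 : S.tgt s = S.src p) (h4 : S.tgt p = S.src t') (h5 : S.tgt t' = S.src a) :
    S.mul (S.mul (S.mul X (S.mul t s)) p) (S.mul t' a) =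
      S.mul X (S.mul t (S.mul (S.mul (S.mul s p) t') a)) := by
  have e1 : S.tgt p = S.src (S.mul t' a) := by rw [S.src_mul _ _ h5]; exact h4
  have e2 : S.tgt s = S.src (S.mul p (S.mul t' a)) := by rw [S.src_mul _ _ e1]; exact h3
  have e3 : S.tgt t = S.src (S.mul s (S.mul p (S.mul t' a))) := by
    rw [S.src_mul _ _ e2]; exact h2
  have e4 : S.tgt (S.mul t s) = S.src p := by rw [S.tgt_mul _ _ h2]; exact h3
  have e5 : S.tgt X = S.src (S.mul t s) := by rw [S.src_mul _ _ h2]; exact h1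
  have e6 : S.tgt (S.mul X (S.mul t s)) = S.src p := by rw [S.tgt_mul _ _ e5]; exact e4
  have e7 : S.tgt (S.mul t s) = S.src (S.mul p (S.mul t' a)) := by
    rw [S.tgt_mul _ _ h2]; exact e2
  have e8 : S.tgt (S.mul s p) = S.src t' := by rw [S.tgt_mul _ _ h3]; exact h4
  rw [S.mul_assoc' _ p _ e6 e1, S.mul_assoc' X _ _ e5 e7, S.mul_assoc' t s _ h2 e2,
    S.mul_assoc' (S.mul s p) t' a e8 h5, S.mul_assoc' s p _ h3 e1]

theorem split_long {n : ℕ} {u : List E} {a : A} (hu : Ev C u a) (hl : ¬ u.length ≤ n + 1)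
    (hg : Good C R n u) : ∃ b c, Ev C (tk n u).1 b ∧ Ev C (u.drop (n + 1)) c ∧
      S.tgt b = S.src c ∧ a = S.mul b c ∧ b ∈ Rees.SPS0 S R := by
  have hu' := hu
  rw [← List.take_append_drop (n + 1) u] at hu'
  obtain ⟨b, c, h1, h2, h3, h4⟩ := hu'.split
    (by rw [← List.length_pos_iff]; simp; omega) (by rw [← List.length_pos_iff]; simp; omega)
  refine ⟨b, c, h1, h2, h3, h4, ?_⟩
  refine hg [] (u.take (n + 1)) (u.drop (n + 1)) ?_ (by simp; omega) b h1
  rw [List.nil_append, List.take_append_drop]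

theorem Dec.src_s (D : Dec R) {b : A} (hb : b ∈ Rees.SPS0 S R) : S.src (D.s b) = S.src b := by
  have h1 := D.h1 b hb
  have h2 := D.h2 b hb
  conv_rhs => rw [D.h3 b hb]
  simp [S.src_mul, S.tgt_mul, *]

theorem Dec.tgt_t (D : Dec R) {b : A} (hb : b ∈ Rees.SPS0 S R) : S.tgt (D.t b) = S.tgt b := by
  have h1 := D.h1 b hb
  have h2 := D.h2 b hb
  conv_rhs => rw [D.h3 b hb]
  simp [S.tgt_mul, *]

theorem foldl_inr (D : Dec R) (a0 : A) {n : ℕ} (lam : Λ) (i : I) (u : List E) :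
    ∀ (b : Blk E n) (β x a : A), vl C a0 b.1 = β → β ∈ Rees.SPS0 S R →
    Rees.Valid S R.F R.G (i, x, D.l β) → Ev C u a → S.tgt β = S.src a → S.tgt a = R.G lam →
    Good C R n u →
    ((enc n lam (Sum.inr b) u).map (labM C D a0)).foldl (Rees.mul0 S R) (mkT R i x (D.l β)) =
      mkT R i (S.mul (S.mul x (D.p β)) (S.mul (D.t β) a)) lam := by
  induction hk : u.length using Nat.strong_induction_on generalizing u with
  | _ k ih =>
  subst hk
  intro b β x a hb hβ hx hu hβa ha hg
  have hta : S.tgt (D.t β) = S.src a := by rw [D.tgt_t hβ]; exact hβa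
  have hP := D.hP β hβ
  have hF : R.F (D.i β) = S.src (D.t β) := by rw [← R.P_tgt _ _ _ hP]; exact D.h2 β hβ
  have hxp : S.tgt x = S.src (D.p β) := by rw [R.P_src _ _ _ hP]; exact hx.2
  by_cases hl : u.length ≤ n + 1
  · rw [enc_short lam _ hl]
    have htk : vl C a0 (tk n u).1 = a := by
      show vl C a0 (u.take (n + 1)) = a
      rw [List.take_of_length_le hl]; exact hu.vl
    simp only [List.map_cons, List.map_nil, List.foldl_cons, List.foldl_nil, labM, lidx, lmul,
      hb, htk]
    refine mul_mkT hx ⟨?_, ?_⟩ hP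
    · show R.F (D.i β) = S.src (S.mul (D.t β) a)
      rw [S.src_mul _ _ hta]; exact hF
    · show S.tgt (S.mul (D.t β) a) = R.G lam
      rw [S.tgt_mul _ _ hta]; exact ha
  · obtain ⟨b', c, h1, h2, h3, rfl, h5⟩ := split_long hu hl hg
    rw [enc_long lam _ hl]
    rw [S.src_mul _ _ h3, ← D.src_s h5] at hta
    rw [S.tgt_mul _ _ h3] at ha
    have hP' := D.hP b' h5
    have e1 := D.h1 b' h5
    have e2 := D.h2 b' h5
    have e3 : S.tgt (D.t b') = S.src c := by rw [D.tgt_t h5]; exact h3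
    have hv : Rees.Valid S R.F R.G (D.i β, S.mul (D.t β) (D.s b'), D.l b') := by
      refine ⟨?_, ?_⟩
      · show R.F (D.i β) = S.src (S.mul (D.t β) (D.s b'))
        rw [S.src_mul _ _ hta]; exact hF
      · show S.tgt (S.mul (D.t β) (D.s b')) = R.G (D.l b')
        rw [S.tgt_mul _ _ hta, e1]; exact R.P_src _ _ _ hP'
    have hv' := Rees.prod_valid S hx hv (R.P_src _ _ _ hP) (R.P_tgt _ _ _ hP)
    have := ih (u.drop (n + 1)).length (by simp; omega) (u.drop (n + 1)) rfl (tk n u) b'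
      _ c h1.vl h5 hv' h2 h3 ha (hg.drop _)
    simp only [List.map_cons, List.foldl_cons, labM, lidx, lmul, hb, h1.vl]
    rw [mul_mkT hx hv hP, this, assoc5 ?_ hta e1 e2 e3, ← D.h3 b' h5]
    rw [S.tgt_mul _ _ hxp]; exact D.h2 β hβ

theorem eval_enc (D : Dec R) (a0 : A) {n : ℕ} {lam : Λ} {i : I} {u : List E} {a : A}
    (hu : Ev C u a) (hg : Good C R n u) (hv : Rees.Valid S R.F R.G (i, a, lam)) :
    evalPath? (Rees.pre0 S R) (labM C D a0 (n := n)) (enc n lam (Sum.inl i) u) =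
      some (mkT R i a lam) := by
  by_cases hl : u.length ≤ n + 1
  · rw [enc_short lam _ hl]
    have htk : vl C a0 (tk n u).1 = a := by
      show vl C a0 (u.take (n + 1)) = a
      rw [List.take_of_length_le hl]; exact hu.vl
    simp [evalPath?, labM, lidx, lmul, htk]
  · obtain ⟨b', c, h1, h2, h3, rfl, h5⟩ := split_long hu hl hg
    obtain ⟨hv1, hv2⟩ := hv
    simp only at hv1 hv2
    rw [S.src_mul _ _ h3] at hv1
    rw [S.tgt_mul _ _ h3] at hv2
    have hP' := D.hP b' h5
    have e1 := D.h1 b' h5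
    have e2 := D.h2 b' h5
    have e3 : S.tgt (D.t b') = S.src c := by rw [D.tgt_t h5]; exact h3
    have hv : Rees.Valid S R.F R.G (i, D.s b', D.l b') := by
      refine ⟨?_, ?_⟩
      · show R.F i = S.src (D.s b')
        rw [D.src_s h5]; exact hv1
      · show S.tgt (D.s b') = R.G (D.l b')
        rw [e1]; exact R.P_src _ _ _ hP'
    rw [enc_long lam _ hl]
    have := foldl_inr (C := C) D a0 lam i _ (tk n u) b' (D.s b') c h1.vl h5 hv h2 h3 hv2 (hg.drop _)
    simp only [evalPath?, labM, lidx, lmul, h1.vl]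
    refine congrArg some (this.trans ?_)
    congr 1
    conv_rhs => rw [D.h3 b' h5]
    simp [S.mul_assoc', S.src_mul, S.tgt_mul, *]

theorem chain_unit {E' : Type} (l : List E') :
    IsPathChain (fun _ : E' => ()) (fun _ : E' => ()) l := by
  cases l with
  | nil => exact List.isChain_nil
  | cons e l =>
    rw [chain_iff]
    induction l with
    | nil => trivial
    | cons f l ih => exact ⟨rfl, ih⟩

/-- Shortest representatives of arrows `a` such that `(i, a, lam)` is valid. -/
def Kil (C : ChoiceOfReps S.toPreSgpd E) (R : Rees.Data0 S I Λ) (i : I) (lam : Λ) :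
    Set (List E) :=
  {u | u ∈ K1 C ∧ ∃ a, Ev C u a ∧ Rees.Valid S R.F R.G (i, a, lam)}

theorem Kil_reg (hC : IsAutomaticStructure C) (i : I) (lam : Λ) : Reg1 (Kil C R i lam) := by
  have h1 := ((K1_reg hC).inter (Reg2.of_sync (hC.2.2.2 (R.G lam))).fst).inter_stream
    (FinQ.head_pred (fun x : Option E => x.map C.esrc = some (R.F i)))
  convert h1 using 1
  ext u
  constructor
  · rintro ⟨hu, a, ha, hv⟩
    refine ⟨⟨hu, u, hu.1, hu.1, ?_, rfl⟩, ?_⟩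
    · show pathTgt? C.etgt u = _
      rw [ha.tgt]; exact congrArg some hv.2
    · show (u[0]?).map C.esrc = _
      rw [← List.head?_eq_getElem?, ha.src]; exact congrArg some hv.1.symm
  · rintro ⟨⟨hu, v, _, _, h2, _⟩, h3⟩
    obtain ⟨a, ha⟩ := Ev.of_mem hu.1
    change (u[0]?).map C.esrc = _ at h3
    rw [← List.head?_eq_getElem?, ha.src] at h3
    change pathTgt? C.etgt u = _ at h2
    rw [ha.tgt] at h2
    exact ⟨hu, a, ha, (Option.some.inj h3).symm, Option.some.inj h2⟩

/-- Normal forms. -/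
def NL (C : ChoiceOfReps S.toPreSgpd E) (R : Rees.Data0 S I Λ) (n : ℕ) :
    Option (I × Λ) → Set (List (Let E I Λ n))
  | none => {[none]}
  | some (i, lam) => {w | ∃ u ∈ Kil C R i lam, w = enc n lam (Sum.inl i) u}

theorem NL_reg [Finite I] (hC : IsAutomaticStructure C) (n : ℕ) (τ : Option (I × Λ)) :
    Reg1 (NL C R n τ) := by
  have := hC.1
  match τ with
  | none => exact Reg1.singleton _
  | some (i, lam) =>
    refine Reg1.enc n i lam (Kil_reg hC i lam) ?_
    rintro u ⟨_, a, ha, _⟩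
    exact ha.ne_nil

theorem NL_ne {n : ℕ} {τ : Option (I × Λ)} {w : List (Let E I Λ n)} (h : w ∈ NL C R n τ) :
    w ≠ [] := by
  match τ with
  | none => rw [show w = [none] from h]; simp
  | some (i, lam) =>
    obtain ⟨u, _, rfl⟩ := h
    exact enc_ne_nil _ _ _

theorem phi_reg [Finite I] [Finite Λ] (hC : IsAutomaticStructure C) (D : Dec R) (a0 : A) {n : ℕ}
    (hn : ∀ u ∈ K1 C, Good C R n u)
    (φ : Rees.Carrier0 S R → Rees.Carrier0 S R) (h0 : φ none = none)
    (hφ : ∀ lam, (∀ i x, Rees.Valid S R.F R.G (i, x, lam) → φ (mkT R i x lam) = none) ∨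
      ∃ c mu, S.src c = R.G lam ∧ S.tgt c = R.G mu ∧
        ∀ i x, Rees.Valid S R.F R.G (i, x, lam) → φ (mkT R i x lam) = mkT R i (S.mul x c) mu) :
    Reg2 {p : List (Let E I Λ n) × List (Let E I Λ n) | p.1 ∈ (⋃ τ, NL C R n τ) ∧
      p.2 ∈ (⋃ τ, NL C R n τ) ∧
      (evalPath? (Rees.pre0 S R) (labM C D a0) p.1).map φ =
        evalPath? (Rees.pre0 S R) (labM C D a0) p.2} := by
  have hfE := hC.1
  have hz : evalPath? (Rees.pre0 S R) (labM C D a0 (n := n)) [none] = some none := rfl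
  have hU : ∀ ττ : Option (I × Λ) × Option (I × Λ),
      Reg2 {p : List (Let E I Λ n) × List (Let E I Λ n) | p.1 ∈ NL C R n ττ.1 ∧
      p.2 ∈ NL C R n ττ.2 ∧ (evalPath? (Rees.pre0 S R) (labM C D a0) p.1).map φ =
        evalPath? (Rees.pre0 S R) (labM C D a0) p.2} := by
    rintro ⟨τ, τ'⟩
    match τ, τ' with
    | none, none =>
      convert Reg2.prod (NL_reg (R := R) hC n none) (NL_reg hC n none) using 1
      ext ⟨w, w'⟩
      constructor
      · rintro ⟨h1, h2, _⟩; exact ⟨h1, h2⟩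
      · rintro ⟨h1, h2⟩
        refine ⟨h1, h2, ?_⟩
        rw [show w = [none] from h1, show w' = [none] from h2]
        rw [hz]; exact congrArg some h0
    | none, some (j, mu) =>
      convert Reg2.empty using 1
      ext ⟨w, w'⟩
      simp only [Set.mem_empty_iff_false, iff_false]
      rintro ⟨h1, ⟨v, ⟨hv, b, hb, hvb⟩, h2⟩, h3⟩
      simp only at h1 h2 h3
      rw [show w = [none] from h1, h2, eval_enc D a0 hb (hn v hv) hvb] at h3
      rw [hz] at h3
      exact mkT_ne hvb ((Option.some.inj h3).symm.trans h0)
    | some (i, lam), none =>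
      rcases hφ lam with hφ | ⟨c, mu, hc1, hc2, hφ⟩
      · convert Reg2.prod (NL_reg (R := R) hC n (some (i, lam))) (NL_reg hC n none) using 1
        ext ⟨w, w'⟩
        constructor
        · rintro ⟨h1, h2, _⟩; exact ⟨h1, h2⟩
        · rintro ⟨h1, h2⟩
          refine ⟨h1, h2, ?_⟩
          obtain ⟨u, ⟨hu, a, ha, hva⟩, h1⟩ := h1
          simp only at h1
          rw [show w' = [none] from h2, h1, eval_enc D a0 ha (hn u hu) hva]
          exact congrArg some (hφ i a hva)
      · convert Reg2.empty using 1
        ext ⟨w, w'⟩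
        simp only [Set.mem_empty_iff_false, iff_false]
        rintro ⟨⟨u, ⟨hu, a, ha, hva⟩, h1⟩, h2, h3⟩
        simp only at h1 h2 h3
        rw [show w' = [none] from h2, h1, eval_enc D a0 ha (hn u hu) hva, Option.map_some,
          hφ i a hva, hz] at h3
        have hac : S.tgt a = S.src c := by rw [hc1]; exact hva.2
        refine mkT_ne ⟨?_, ?_⟩ (Option.some.inj h3)
        · show R.F i = S.src (S.mul a c)
          rw [S.src_mul _ _ hac]; exact hva.1
        · show S.tgt (S.mul a c) = R.G mu
          rw [S.tgt_mul _ _ hac]; exact hc2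
    | some (i, lam), some (j, mu') =>
      rcases hφ lam with hφ | ⟨c, mu, hc1, hc2, hφ⟩
      · convert Reg2.empty using 1
        ext ⟨w, w'⟩
        simp only [Set.mem_empty_iff_false, iff_false]
        rintro ⟨⟨u, ⟨hu, a, ha, hva⟩, h1⟩, ⟨v, ⟨hv, b, hb, hvb⟩, h2⟩, h3⟩
        simp only at h1 h2 h3
        rw [h1, h2, eval_enc D a0 ha (hn u hu) hva, eval_enc D a0 hb (hn v hv) hvb,
          Option.map_some, hφ i a hva] at h3
        exact mkT_ne hvb (Option.some.inj h3).symm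
      · have hval : ∀ a, Rees.Valid S R.F R.G (i, a, lam) → S.tgt a = S.src c ∧
            Rees.Valid S R.F R.G (i, S.mul a c, mu) := by
          intro a hva
          have hac : S.tgt a = S.src c := by rw [hc1]; exact hva.2
          refine ⟨hac, ?_, ?_⟩
          · show R.F i = S.src (S.mul a c)
            rw [S.src_mul _ _ hac]; exact hva.1
          · show S.tgt (S.mul a c) = R.G mu
            rw [S.tgt_mul _ _ hac]; exact hc2
        by_cases hij : i = j ∧ mu = mu'
        · obtain ⟨rfl, rfl⟩ := hij
          convert Reg2.enc n i i lam mu ((relC_reg hC c).inter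
            (Reg2.prod (Kil_reg (R := R) hC i lam) (Kil_reg (R := R) hC i mu))) ?_ using 1
          · ext ⟨w, w'⟩
            constructor
            · rintro ⟨⟨u, ⟨hu, a, ha, hva⟩, h1⟩, ⟨v, ⟨hv, b, hb, hvb⟩, h2⟩, h3⟩
              simp only at h1 h2 h3
              rw [h1, h2, eval_enc D a0 ha (hn u hu) hva, eval_enc D a0 hb (hn v hv) hvb,
                Option.map_some, hφ i a hva] at h3
              have he := (mkT_inj (hval a hva).2 hvb (Option.some.inj h3)).2.1
              subst he
              exact ⟨u, v, ⟨⟨hu.1, hv.1, a, ha, (hval a hva).1, hb⟩,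
                ⟨hu, a, ha, hva⟩, ⟨hv, _, hb, hvb⟩⟩, h1, h2⟩
            · rintro ⟨u, v, ⟨⟨_, _, a, ha, hac, hb⟩, ⟨hu, a', ha', hva⟩, ⟨hv, b, hb', hvb⟩⟩, h1, h2⟩
              simp only at ha ha' hb hb' hu hv h1 h2
              have e1 := ha'.unique ha
              have e2 := hb'.unique hb
              subst e1 e2
              refine ⟨⟨u, ⟨hu, _, ha, hva⟩, h1⟩, ⟨v, ⟨hv, _, hb, hvb⟩, h2⟩, ?_⟩
              simp only
              rw [h1, h2, eval_enc D a0 ha (hn u hu) hva, eval_enc D a0 hb (hn v hv) hvb,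
                Option.map_some, hφ i _ hva]
          · rintro ⟨u, v⟩ ⟨_, ⟨_, a, ha, _⟩, ⟨_, b, hb, _⟩⟩
            exact ⟨ha.ne_nil, hb.ne_nil⟩
        · convert Reg2.empty using 1
          ext ⟨w, w'⟩
          simp only [Set.mem_empty_iff_false, iff_false]
          rintro ⟨⟨u, ⟨hu, a, ha, hva⟩, h1⟩, ⟨v, ⟨hv, b, hb, hvb⟩, h2⟩, h3⟩
          simp only at h1 h2 h3
          rw [h1, h2, eval_enc D a0 ha (hn u hu) hva, eval_enc D a0 hb (hn v hv) hvb,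
            Option.map_some, hφ i a hva] at h3
          have he := mkT_inj (hval a hva).2 hvb (Option.some.inj h3)
          exact hij ⟨he.1, he.2.2⟩
  convert Reg2.iUnion hU using 1
  ext ⟨w, w'⟩
  simp only [Set.mem_iUnion, Set.mem_ofPred_eq]
  constructor
  · rintro ⟨⟨τ, h1⟩, ⟨τ', h2⟩, h3⟩
    exact ⟨(τ, τ'), h1, h2, h3⟩
  · rintro ⟨⟨τ, τ'⟩, h1, h2, h3⟩
    exact ⟨⟨τ, h1⟩, ⟨τ', h2⟩, h3⟩

theorem eval_snoc {O' A' E' : Type} (T : PreSgpd O' A') (lab : E' → A') {l : List E'} (hl : l ≠ [])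
    (a : E') : evalPath? T lab (l ++ [a]) =
      (evalPath? T lab l).map (fun m => T.mul m (lab a)) := by
  cases l with
  | nil => exact absurd rfl hl
  | cons e l => simp [evalPath?]

/-- The choice of representatives for the Rees matrix semigroup. -/
noncomputable def repM (C : ChoiceOfReps S.toPreSgpd E) (D : Dec R) (a0 : A) (n : ℕ)
    (hn : ∀ u ∈ K1 C, Good C R n u) : ChoiceOfReps (Rees.pre0 S R) (Let E I Λ n) where
  esrc _ := ()
  etgt _ := ()
  lab := labM C D a0
  lab_src _ := rfl
  lab_tgt _ := rfl
  K := ⋃ τ, NL C R n τ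
  K_path l hl := by
    obtain ⟨τ, hτ⟩ := Set.mem_iUnion.1 hl
    exact ⟨NL_ne hτ, chain_unit l⟩
  K_onto m := by
    cases m with
    | none => exact ⟨[none], Set.mem_iUnion.2 ⟨none, rfl⟩, rfl⟩
    | some t =>
      obtain ⟨⟨i, a, lam⟩, hv⟩ := t
      obtain ⟨u, hu, ha⟩ := K1_onto C a
      refine ⟨_, Set.mem_iUnion.2 ⟨some (i, lam), u, ⟨hu, a, ha, hv⟩, rfl⟩, ?_⟩
      rw [eval_enc D a0 ha (hn u hu) hv, mkT_valid hv]

end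

theorem main_aux {O A I Λ : Type} (S : Sgpd O A) (hne : Nonempty A)
    (hcat : IsSmallCategory S.toPreSgpd)
    (R : Rees.Data0 S I Λ)
    (hS : IsAutomatic S.toPreSgpd)
    (hfg : IsFG (Rees.pre0 S R)) :
    IsAutomatic (Rees.pre0 S R) := by
  obtain ⟨E, C, hC⟩ := hS
  obtain ⟨hI, hΛ, hfin⟩ := fg_finite hfg
  obtain ⟨D⟩ := Dec.nonempty R hne
  obtain ⟨a0⟩ := hne
  have hE := hC.1
  obtain ⟨n, hn⟩ := bound hC (Rees.SPS0 S R) hfin (fun a ha b h => SPS0_ideal ha h)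
  have hn' : ∀ u ∈ K1 C, Good C R n u := by
    intro u hu x w z he hw b hb
    subst he
    exact hn x w z hu hw b hb
  have hpath : ∀ w ∈ (⋃ τ, NL C R n τ), pathTgt? (fun _ : Let E I Λ n => ()) w = some () := by
    intro w hw
    obtain ⟨τ, hτ⟩ := Set.mem_iUnion.1 hw
    rw [pathTgt?, List.getLast?_eq_some_getLast (NL_ne hτ)]; rfl
  have hnn : ∀ w ∈ (⋃ τ, NL C R n τ), w ≠ [] := by
    intro w hw
    obtain ⟨τ, hτ⟩ := Set.mem_iUnion.1 hw
    exact NL_ne hτ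
  refine ⟨Let E I Λ n, repM C D a0 n hn', inferInstance, ?_, ?_, ?_⟩
  · exact Reg1.regular (Reg1.iUnion (fun τ => NL_reg hC n τ))
  · intro g
    apply Reg2.sync
    · convert phi_reg hC D a0 hn' (fun m => Rees.mul0 S R m (labM C D a0 g)) rfl ?_ using 1
      · ext ⟨w, w'⟩
        refine and_congr_right fun hw => and_congr_right fun hw' => ?_
        constructor
        · rintro ⟨_, h⟩
          rw [eval_snoc _ _ (hnn w hw)] at h
          exact h
        · intro h
          refine ⟨hpath w hw, ?_⟩
          rw [eval_snoc _ _ (hnn w hw)]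
          exact h
      · intro lam
        cases hg : labM C D a0 g with
        | none => exact Or.inl fun i x _ => mul0_none _
        | some t =>
          obtain ⟨⟨j, y, mu⟩, hy⟩ := t
          rw [← mkT_valid hy]
          cases hp : R.P lam j with
          | none => exact Or.inl fun i x hx => mul_mkT_zero hx hy hp
          | some p =>
            have h1 := R.P_src _ _ _ hp
            have h2 : S.tgt p = S.src y := (R.P_tgt _ _ _ hp).trans hy.1
            refine Or.inr ⟨S.mul p y, mu, ?_, ?_, fun i x hx => ?_⟩
            · rw [S.src_mul _ _ h2, h1]
            · rw [S.tgt_mul _ _ h2]; exact hy.2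
            · show Rees.mul0 S R _ _ = _
              rw [mul_mkT hx hy hp, S.mul_assoc' _ _ _ ?_ h2]
              rw [h1]; exact hx.2
    · rintro p ⟨h1, h2, _⟩
      exact ⟨hnn _ h1, hnn _ h2⟩
  · intro v
    apply Reg2.sync
    · convert phi_reg hC D a0 hn' id rfl ?_ using 1
      · ext ⟨w, w'⟩
        refine and_congr_right fun hw => and_congr_right fun hw' => ?_
        rw [Option.map_id]
        constructor
        · rintro ⟨_, h⟩
          exact h
        · intro h
          exact ⟨hpath w hw, h⟩
      · intro lam
        obtain ⟨e, he1, he2, he3⟩ := hcat (R.G lam)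
        refine Or.inr ⟨e, lam, he1, he2, fun i x hx => ?_⟩
        rw [he3.2 x (by rw [he1]; exact hx.2)]
        rfl
    · rintro p ⟨h1, h2, _⟩
      exact ⟨hnn _ h1, hnn _ h2⟩

/-- Theorem 4.3: a finitely generated Rees matrix semigroup with zero over an
automatic small category is automatic. -/
theorem stmt_7 {O A I Λ : Type} (S : Sgpd O A) (hne : Nonempty A)
    (hiso : IsolationFree S.toPreSgpd) (hcat : IsSmallCategory S.toPreSgpd)
    (R : Rees.Data0 S I Λ)
    (hS : IsAutomatic S.toPreSgpd)
    (hfg : IsFG (Rees.pre0 S R)) :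
    IsAutomatic (Rees.pre0 S R) := by
  exact main_aux S hne hcat R hS hfg

end AutoRees
end
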